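/- Let m ≥ 2 be an even integer, 0 ≤ β < 2m, and suppose the continuous coefficients a_γ satisfy (A1). Let (w_k) be a sequence of smooth functions on ℝ^{2m} with ∫ Σ_{γ=0}^m |∇^γ w_k|² dx < ∞ and ‖w_k‖_E = 1 for all k, and let w₀ be a smooth function with ‖w₀‖_E ≤ 1 such that the E-inner products satisfy ⟨w_k, v⟩_E → ⟨w₀, v⟩_E as k → ∞ for every smooth v of finite E-norm (weak convergence w_k ⇀ w₀ in E). Then for every p with 0 < p < (1 − β/(2m))·(4π)^m·m!/(1 − ‖w₀‖_E²), one has sup_k ∫_{ℝ^{2m}} (e^{p w_k²} − 1)/|x|^β dx < ∞. (Singular Lions-type concentration-compactness inequality, Lemma 4.4; when ‖w₀‖_E = 1 the conclusion holds for every p > 0.) -/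

import Mathlib

open MeasureTheory Real Filter Topology

noncomputable section

abbrev Euc (n : ℕ) := EuclideanSpace ℝ (Fin n)

/-- The Laplacian of `u : ℝⁿ → ℝ`, computed as the sum of second partial derivatives. -/
noncomputable def lap (n : ℕ) (u : Euc n → ℝ) : Euc n → ℝ :=
  fun x => ∑ i : Fin n,
    fderiv ℝ (fun y => fderiv ℝ u y (EuclideanSpace.single i 1)) x (EuclideanSpace.single i 1)

/-- Iterated Laplacian `Δ^k u`. -/
noncomputable def lapIter (n : ℕ) : ℕ → (Euc n → ℝ) → (Euc n → ℝ)
  | 0 => id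
  | k+1 => fun u => lap n (lapIter n k u)

/-- `|∇^γ u|²`, where `∇^γ u = Δ^{γ/2} u` for even `γ` and `∇^γ u = ∇(Δ^{(γ-1)/2} u)` for odd. -/
noncomputable def gradNormSq (n γ : ℕ) (u : Euc n → ℝ) : Euc n → ℝ :=
  fun x => if γ % 2 = 0 then (lapIter n (γ/2) u x)^2
    else ∑ i : Fin n, (fderiv ℝ (lapIter n (γ/2) u) x (EuclideanSpace.single i 1))^2


/-- Pointwise inner product `∇^γ u · ∇^γ v` of the `γ`-th order gradients. -/
noncomputable def gradInner (n γ : ℕ) (u v : Euc n → ℝ) : Euc n → ℝ :=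
  fun x => if γ % 2 = 0 then lapIter n (γ/2) u x * lapIter n (γ/2) v x
    else ∑ i : Fin n, fderiv ℝ (lapIter n (γ/2) u) x (EuclideanSpace.single i 1) *
      fderiv ℝ (lapIter n (γ/2) v) x (EuclideanSpace.single i 1)

section
open scoped ContDiff in
lemma cd_D {n : ℕ} {u : Euc n → ℝ} (hu : ContDiff ℝ ∞ u) (e : Euc n) :
    ContDiff ℝ ∞ (fun y => fderiv ℝ u y e) := by
  have : ContDiff ℝ ∞ (fderiv ℝ u) := hu.fderiv_right (by simp)
  exact this.clm_apply contDiff_const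

open scoped ContDiff in
lemma cd_lap {n : ℕ} {u : Euc n → ℝ} (hu : ContDiff ℝ ∞ u) : ContDiff ℝ ∞ (lap n u) := by
  unfold lap
  exact ContDiff.sum fun i _ => cd_D (cd_D hu _) _

open scoped ContDiff in
lemma cd_lapIter {n : ℕ} {u : Euc n → ℝ} (hu : ContDiff ℝ ∞ u) (k : ℕ) :
    ContDiff ℝ ∞ (lapIter n k u) := by
  induction k with
  | zero => simpa [lapIter] using hu
  | succ k ih => exact cd_lap ih

open scoped ContDiff in
lemma cd_diff {n : ℕ} {u : Euc n → ℝ} (hu : ContDiff ℝ ∞ u) : Differentiable ℝ u :=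
  hu.differentiable (by simp)

open scoped ContDiff in
lemma D_sub {n : ℕ} {u v : Euc n → ℝ} (hu : ContDiff ℝ ∞ u) (hv : ContDiff ℝ ∞ v) (e : Euc n) :
    (fun y => fderiv ℝ (fun x => u x - v x) y e) = fun y => fderiv ℝ u y e - fderiv ℝ v y e := by
  funext y
  rw [fderiv_fun_sub (cd_diff hu y) (cd_diff hv y)]; rfl

open scoped ContDiff in
lemma lap_sub {n : ℕ} {u v : Euc n → ℝ} (hu : ContDiff ℝ ∞ u) (hv : ContDiff ℝ ∞ v) :
    lap n (fun x => u x - v x) = fun x => lap n u x - lap n v x := by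
  funext x
  unfold lap
  rw [← Finset.sum_sub_distrib]
  refine Finset.sum_congr rfl fun i _ => ?_
  rw [D_sub hu hv]
  exact congrFun (D_sub (cd_D hu _) (cd_D hv _) _) x

open scoped ContDiff in
lemma lapIter_sub {n : ℕ} {u v : Euc n → ℝ} (hu : ContDiff ℝ ∞ u) (hv : ContDiff ℝ ∞ v) (k : ℕ) :
    lapIter n k (fun x => u x - v x) = fun x => lapIter n k u x - lapIter n k v x := by
  induction k with
  | zero => rfl
  | succ k ih =>
    simp only [lapIter]
    rw [ih]
    exact lap_sub (cd_lapIter hu k) (cd_lapIter hv k)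

open scoped ContDiff in
lemma D_mul {n : ℕ} {u v : Euc n → ℝ} (hu : ContDiff ℝ ∞ u) (hv : ContDiff ℝ ∞ v) (e : Euc n) :
    (fun y => fderiv ℝ (fun x => u x * v x) y e)
      = fun y => u y * fderiv ℝ v y e + v y * fderiv ℝ u y e := by
  funext y
  rw [fderiv_fun_mul (cd_diff hu y) (cd_diff hv y)]
  simp

open scoped ContDiff in
lemma DD_mul {n : ℕ} {u v : Euc n → ℝ} (hu : ContDiff ℝ ∞ u) (hv : ContDiff ℝ ∞ v) (e : Euc n)
    (x : Euc n) :
    fderiv ℝ (fun y => fderiv ℝ (fun x => u x * v x) y e) x e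
      = u x * fderiv ℝ (fun y => fderiv ℝ v y e) x e
        + 2 * (fderiv ℝ u x e * fderiv ℝ v x e)
        + v x * fderiv ℝ (fun y => fderiv ℝ u y e) x e := by
  rw [D_mul hu hv]
  have h1 : ContDiff ℝ ∞ fun y => u y * fderiv ℝ v y e := hu.mul (cd_D hv e)
  have h2 : ContDiff ℝ ∞ fun y => v y * fderiv ℝ u y e := hv.mul (cd_D hu e)
  rw [fderiv_fun_add (cd_diff h1 x) (cd_diff h2 x)]
  have e1 := congrFun (D_mul hu (cd_D hv e) e) x
  have e2 := congrFun (D_mul hv (cd_D hu e) e) x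
  simp only [ContinuousLinearMap.add_apply]
  rw [e1, e2]; ring

open scoped ContDiff in
lemma D_scale {n : ℕ} {u : Euc n → ℝ} (hu : ContDiff ℝ ∞ u) (r : ℝ) (e : Euc n) :
    (fun y => fderiv ℝ (fun x => u (r • x)) y e) = fun y => r * fderiv ℝ u (r • y) e := by
  funext y
  have h1 : HasFDerivAt (fun x : Euc n => r • x) (r • ContinuousLinearMap.id ℝ (Euc n)) y :=
    (hasFDerivAt_id y).const_smul r
  have h2 := ((cd_diff hu (r • y)).hasFDerivAt).comp y h1
  have h3 : fderiv ℝ (fun x => u (r • x)) y = _ := h2.fderiv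
  rw [h3]; simp

open scoped ContDiff in
lemma DD_scale {n : ℕ} {u : Euc n → ℝ} (hu : ContDiff ℝ ∞ u) (r : ℝ) (e : Euc n) (x : Euc n) :
    fderiv ℝ (fun y => fderiv ℝ (fun x => u (r • x)) y e) x e
      = r ^ 2 * fderiv ℝ (fun y => fderiv ℝ u y e) (r • x) e := by
  rw [D_scale hu]
  have h := congrFun (D_scale (cd_D hu e) r e) x
  have hc : ContDiff ℝ ∞ fun y => fderiv ℝ u (r • y) e :=
    (cd_D hu e).comp (contDiff_const_smul r)
  rw [fderiv_const_mul (cd_diff hc x)]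
  simp only [ContinuousLinearMap.smul_apply, smul_eq_mul]
  rw [h]; ring

open scoped SchwartzMap LineDeriv Laplacian

lemma lap_schwartz {n : ℕ} (η : 𝓢(Euc n, ℝ)) : lap n (η : Euc n → ℝ) = (Δ η : 𝓢(Euc n, ℝ)) := by
  funext x
  rw [SchwartzMap.laplacian_eq_sum (EuclideanSpace.basisFun (Fin n) ℝ)]
  simp only [lap, sum_apply, EuclideanSpace.basisFun_apply]
  rfl

lemma sch_cd {n : ℕ} (η : 𝓢(Euc n, ℝ)) : ContDiff ℝ (⊤ : ℕ∞) (η : Euc n → ℝ) := η.smooth ⊤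

lemma ibp_cs {n : ℕ} {v ζ : Euc n → ℝ} (hv : ContDiff ℝ (⊤ : ℕ∞) v) (hζ : ContDiff ℝ (⊤ : ℕ∞) ζ)
    (hs : HasCompactSupport ζ) : ∫ x, v x * lap n ζ x = ∫ x, lap n v x * ζ x := by
  have hsD : ∀ e, HasCompactSupport (fun y => fderiv ℝ ζ y e) := fun e => hs.fderiv_apply ℝ e
  have hsDD : ∀ e, HasCompactSupport (fun x => fderiv ℝ (fun y => fderiv ℝ ζ y e) x e) :=
    fun e => (hsD e).fderiv_apply ℝ e
  have key : ∀ {f g : Euc n → ℝ}, ContDiff ℝ (⊤ : ℕ∞) f → ContDiff ℝ (⊤ : ℕ∞) g →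
      HasCompactSupport g → Integrable (fun x => f x * g x) := by
    intro f g hf hg hgs
    exact (hf.continuous.mul hg.continuous).integrable_of_hasCompactSupport hgs.mul_left
  have ibp : ∀ {f g : Euc n → ℝ} (e : Euc n), ContDiff ℝ (⊤ : ℕ∞) f → ContDiff ℝ (⊤ : ℕ∞) g →
      HasCompactSupport g → ∫ x, f x * fderiv ℝ g x e = - ∫ x, fderiv ℝ f x e * g x := by
    intro f g e hf hg hgs
    refine integral_mul_fderiv_eq_neg_fderiv_mul_of_integrable (key (cd_D hf e) hg hgs)
      (key hf (cd_D hg e) (hgs.fderiv_apply ℝ e)) (key hf hg hgs) (fun x _ => cd_diff hf x)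
      (fun x _ => cd_diff hg x)
  simp only [lap, Finset.mul_sum, Finset.sum_mul]
  rw [integral_finsetSum _ (fun i _ => key hv (cd_D (cd_D hζ _) _) (hsDD _)),
    integral_finsetSum _ (fun i _ => key (cd_D (cd_D hv _) _) hζ hs)]
  refine Finset.sum_congr rfl fun i _ => ?_
  rw [ibp _ hv (cd_D hζ _) (hsD _), ibp _ (cd_D hv _) hζ hs, neg_neg]

lemma sch_bdd {n : ℕ} (η : 𝓢(Euc n, ℝ)) : ∃ C, 0 ≤ C ∧ ∀ x, |η x| ≤ C := by
  obtain ⟨C, hC0, hC⟩ := η.decay 0 0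
  exact ⟨C, hC0.le, fun x => by simpa using hC x⟩

lemma ibp_schwartz {n : ℕ} {v : Euc n → ℝ} (hv : ContDiff ℝ (⊤ : ℕ∞) v) (h2 : MemLp v 2)
    (hl : MemLp (lap n v) 2) (η : 𝓢(Euc n, ℝ)) :
    ∫ x, v x * lap n η x = ∫ x, lap n v x * η x := by
  -- cutoff
  let b : ContDiffBump (0 : Euc n) := ⟨1, 2, by norm_num, by norm_num⟩
  have hbcd : ContDiff ℝ (⊤ : ℕ∞) (b : Euc n → ℝ) := b.contDiff
  let χ : 𝓢(Euc n, ℝ) := b.hasCompactSupport.toSchwartzMap hbcd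
  let r : ℕ → ℝ := fun k => 1 / ((k : ℝ) + 1)
  have hr0 : ∀ k, 0 < r k := fun k => by positivity
  have hr1 : ∀ k, r k ≤ 1 := fun k => by
    simp only [r]; rw [div_le_one (by positivity)]; linarith [Nat.cast_nonneg (α := ℝ) k]
  have hrt : Tendsto r atTop (𝓝 0) := tendsto_one_div_add_atTop_nhds_zero_nat
  let χk : ℕ → Euc n → ℝ := fun k x => χ (r k • x)
  have hχcd : ContDiff ℝ (⊤ : ℕ∞) (χ : Euc n → ℝ) := sch_cd χ
  have hχk : ∀ k, ContDiff ℝ (⊤ : ℕ∞) (χk k) := fun k => hχcd.comp (contDiff_const_smul (r k))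
  have hχs : ∀ k, HasCompactSupport (χk k) := fun k =>
    b.hasCompactSupport.comp_smul (hr0 k).ne'
  have hη := sch_cd η
  have main : ∀ k, ∫ x, v x * lap n (fun x => χk k x * η x) x = ∫ x, lap n v x * (χk k x * η x) :=
    fun k => ibp_cs hv ((hχk k).mul hη) ((hχs k).mul_right)
  have hχrt : ∀ x, Tendsto (fun k => χk k x) atTop (𝓝 1) := by
    intro x
    have h1 : Tendsto (fun k => χ (r k • x)) atTop (𝓝 (χ ((0:ℝ) • x))) :=
      (χ.continuous.tendsto _).comp (hrt.smul_const x)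
    have : χ ((0:ℝ) • x) = 1 := by
      rw [zero_smul]
      exact b.one_of_mem_closedBall (by simp [b])
    rwa [this] at h1
  obtain ⟨C0, hC0, hb0⟩ := sch_bdd χ
  have hD : ∀ i : Fin n, ∃ C, 0 ≤ C ∧ ∀ x, |fderiv ℝ χ x (EuclideanSpace.single i 1)| ≤ C :=
    fun i => sch_bdd (∂_{EuclideanSpace.single i (1:ℝ)} χ)
  have hDD : ∀ i : Fin n, ∃ C, 0 ≤ C ∧ ∀ x, |fderiv ℝ (fun y => fderiv ℝ χ y
      (EuclideanSpace.single i 1)) x (EuclideanSpace.single i 1)| ≤ C :=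
    fun i => sch_bdd (∂_{EuclideanSpace.single i (1:ℝ)} (∂_{EuclideanSpace.single i (1:ℝ)} χ))
  choose C1 hC1 hb1 using hD
  choose C2 hC2 hb2 using hDD
  have ml : ∀ (g : Euc n → ℝ), MemLp g 2 → ∀ θ : 𝓢(Euc n, ℝ), Integrable (fun x => |g x| * |θ x|) :=
    fun g hg θ => by
      have := hg.norm.integrable_mul (θ.memLp 2).norm
      exact this
  have lim1 : Tendsto (fun k => ∫ x, lap n v x * (χk k x * η x)) atTop
      (𝓝 (∫ x, lap n v x * η x)) := by
    refine tendsto_integral_of_dominated_convergence (fun x => C0 * (|lap n v x| * |η x|)) ?_ ?_ ?_ ?_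
    · intro k
      exact ((cd_lap hv).continuous.mul ((hχk k).continuous.mul hη.continuous)).aestronglyMeasurable
    · exact (ml _ hl η).const_mul _
    · intro k
      refine Eventually.of_forall fun x => ?_
      rw [Real.norm_eq_abs, abs_mul, abs_mul]
      have := hb0 (r k • x)
      calc _ = |χk k x| * (|lap n v x| * |η x|) := by ring
        _ ≤ _ := by gcongr
    · refine Eventually.of_forall fun x => ?_
      have := ((hχrt x).mul_const (η x)).const_mul (lap n v x)
      simpa using this
  have lim2 : Tendsto (fun k => ∫ x, v x * lap n (fun x => χk k x * η x) x) atTop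
      (𝓝 (∫ x, v x * lap n η x)) := by
    have form : ∀ k x, lap n (fun x => χk k x * η x) x = ∑ i : Fin n,
        (χk k x * fderiv ℝ (fun y => fderiv ℝ η y (EuclideanSpace.single i 1)) x
            (EuclideanSpace.single i 1)
          + 2 * ((r k * fderiv ℝ χ (r k • x) (EuclideanSpace.single i 1)) *
              fderiv ℝ η x (EuclideanSpace.single i 1))
          + η x * (r k ^ 2 * fderiv ℝ (fun y => fderiv ℝ χ y
              (EuclideanSpace.single i 1)) (r k • x) (EuclideanSpace.single i 1))) := by
      intro k x
      unfold lap
      refine Finset.sum_congr rfl fun i _ => ?_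
      rw [DD_mul (hχk k) hη]
      rw [show χk k = fun x => χ (r k • x) from rfl, DD_scale hχcd]
      have := congrFun (D_scale hχcd (r k) (EuclideanSpace.single i (1:ℝ))) x

      rw [this]
    refine tendsto_integral_of_dominated_convergence (fun x => ∑ i : Fin n,
      (C0 * (|v x| * |(∂_{EuclideanSpace.single i (1:ℝ)} (∂_{EuclideanSpace.single i (1:ℝ)} η)) x|)
        + 2 * C1 i * (|v x| * |(∂_{EuclideanSpace.single i (1:ℝ)} η) x|)
        + C2 i * (|v x| * |η x|))) ?_ ?_ ?_ ?_
    · intro k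
      exact (hv.continuous.mul (cd_lap ((hχk k).mul hη)).continuous).aestronglyMeasurable
    · refine integrable_finsetSum _ fun i _ => ?_
      exact (((ml _ h2 _).const_mul _).add ((ml _ h2 _).const_mul _)).add ((ml _ h2 _).const_mul _)
    · intro k
      refine Eventually.of_forall fun x => ?_
      rw [form, Real.norm_eq_abs, Finset.mul_sum]
      refine (Finset.abs_sum_le_sum_abs _ _).trans (Finset.sum_le_sum fun i _ => ?_)
      rw [abs_mul]
      have e1 : (∂_{EuclideanSpace.single i (1:ℝ)} (∂_{EuclideanSpace.single i (1:ℝ)} η)) x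
        = fderiv ℝ (fun y => fderiv ℝ η y (EuclideanSpace.single i 1)) x
            (EuclideanSpace.single i 1) := rfl
      have e2 : (∂_{EuclideanSpace.single i (1:ℝ)} η) x
        = fderiv ℝ η x (EuclideanSpace.single i 1) := rfl
      rw [e1, e2]
      have t0 := hb0 (r k • x)
      have t1 := hb1 i (r k • x)
      have t2 := hb2 i (r k • x)
      generalize fderiv ℝ (fun y => fderiv ℝ η y (EuclideanSpace.single i 1)) x
            (EuclideanSpace.single i 1) = A at *
      generalize fderiv ℝ η x (EuclideanSpace.single i 1) = B at *
      generalize fderiv ℝ (fun y => fderiv ℝ χ y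
              (EuclideanSpace.single i 1)) (r k • x) (EuclideanSpace.single i 1) = A' at *
      generalize fderiv ℝ χ (r k • x) (EuclideanSpace.single i 1) = B' at *
      have hχ' : |χk k x| ≤ C0 := t0
      have rk0 := (hr0 k).le
      have rk1 := hr1 k
      have h3 : |χk k x * A + 2 * (r k * B' * B) + η x * (r k ^ 2 * A')|
          ≤ C0 * |A| + 2 * C1 i * |B| + C2 i * |η x| := by
        refine (abs_add_three _ _ _).trans ?_
        rw [abs_mul, abs_mul, abs_mul, abs_mul, abs_mul, abs_mul, abs_of_nonneg rk0,
          abs_of_nonneg (pow_nonneg rk0 2), abs_two]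
        have hk2 : r k ^ 2 ≤ 1 := pow_le_one₀ rk0 rk1
        have u1 : r k * |B'| ≤ 1 * C1 i := by gcongr
        have u2 : r k ^ 2 * |A'| ≤ 1 * C2 i := by gcongr
        rw [one_mul] at u1 u2
        have w1 : |χk k x| * |A| ≤ C0 * |A| := by gcongr
        have w2 : 2 * (r k * |B'| * |B|) ≤ 2 * (C1 i * |B|) := by gcongr
        have w3 : |η x| * (r k ^ 2 * |A'|) ≤ |η x| * C2 i := by gcongr
        linarith
      calc _ ≤ |v x| * (C0 * |A| + 2 * C1 i * |B| + C2 i * |η x|) := by gcongr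
        _ = _ := by ring
    · refine Eventually.of_forall fun x => ?_
      refine Tendsto.const_mul _ ?_
      simp_rw [form]
      unfold lap
      refine tendsto_finsetSum _ fun i _ => ?_
      have hr2 : Tendsto (fun k => r k ^ 2) atTop (𝓝 0) := by simpa using hrt.pow 2
      have a1 := (hχrt x).mul_const (fderiv ℝ (fun y => fderiv ℝ η y (EuclideanSpace.single i 1)) x
            (EuclideanSpace.single i 1))
      have a2 : Tendsto (fun k => r k * fderiv ℝ χ (r k • x) (EuclideanSpace.single i 1)) atTop (𝓝 0) :=
        squeeze_zero_norm (a := fun k => r k * C1 i) (fun k => by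
          rw [Real.norm_eq_abs, abs_mul, abs_of_nonneg (hr0 k).le]
          exact mul_le_mul_of_nonneg_left (hb1 i _) (hr0 k).le) (by simpa using hrt.mul_const (C1 i))
      have a3 : Tendsto (fun k => r k ^ 2 * fderiv ℝ (fun y => fderiv ℝ χ y
              (EuclideanSpace.single i 1)) (r k • x) (EuclideanSpace.single i 1)) atTop (𝓝 0) :=
        squeeze_zero_norm (a := fun k => r k ^ 2 * C2 i) (fun k => by
          rw [Real.norm_eq_abs, abs_mul, abs_of_nonneg (pow_nonneg (hr0 k).le 2)]
          exact mul_le_mul_of_nonneg_left (hb2 i _) (pow_nonneg (hr0 k).le 2))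
          (by simpa using hr2.mul_const (C2 i))
      have := (a1.add ((a2.mul_const (fderiv ℝ η x (EuclideanSpace.single i 1))).const_mul 2)).add
        (a3.const_mul (η x))
      simpa using this
  refine tendsto_nhds_unique lim2 ?_
  simp_rw [main]
  exact lim1

lemma ibp_iter {n : ℕ} {u : Euc n → ℝ} (hu : ContDiff ℝ (⊤ : ℕ∞) u) (M : ℕ)
    (h2 : ∀ j ≤ M, MemLp (lapIter n j u) 2) (η : 𝓢(Euc n, ℝ)) :
    ∫ x, u x * ((fun ψ : 𝓢(Euc n, ℝ) => Δ ψ)^[M] η) x = ∫ x, lapIter n M u x * η x := by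
  induction M generalizing η with
  | zero => rfl
  | succ M ih =>
    rw [Function.iterate_succ_apply, ih (fun j hj => h2 j (by omega)) (Δ η), ← lap_schwartz]
    exact ibp_schwartz (cd_lapIter hu M) (h2 M (by omega)) (h2 (M+1) le_rfl) η

lemma lapIter_schwartz {n : ℕ} (η : 𝓢(Euc n, ℝ)) (M : ℕ) :
    lapIter n M (η : Euc n → ℝ) = ((fun ψ : 𝓢(Euc n, ℝ) => Δ ψ)^[M] η : 𝓢(Euc n, ℝ)) := by
  induction M with
  | zero => rfl
  | succ M ih =>
    rw [Function.iterate_succ_apply']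
    simp only [lapIter]
    rw [ih, lap_schwartz]

end

section
open scoped SchwartzMap LineDeriv Laplacian FourierTransform

lemma tg_norm_pow {n : ℕ} (c : ℝ) (hc : 0 < c) (M : ℕ) :
    (fun ξ : Euc n => (c + ((2*π)^2 * ‖ξ‖^2)^M)⁻¹).HasTemperateGrowth := by
  set l : ℝ := (2*π)^M / Real.sqrt c with hl
  have hl2 : l^2 = ((2*π)^2)^M / c := by
    rw [hl, div_pow, Real.sq_sqrt hc.le, ← pow_mul, ← pow_mul, mul_comm M 2]
  have main : (fun ξ : Euc n => (1 + l^2 * (‖ξ‖^2)^M) ^ (-1:ℝ)).HasTemperateGrowth := by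
    rcases Nat.even_or_odd' M with ⟨k, hk | hk⟩
    · have hy : (fun ξ : Euc n => l * (‖ξ‖^2)^k).HasTemperateGrowth := by fun_prop
      have h := (Function.hasTemperateGrowth_one_add_norm_sq_rpow ℝ (-1)).comp hy
      have e : (fun ξ : Euc n => (1 + l^2 * (‖ξ‖^2)^M) ^ (-1:ℝ)) =
          (fun x : ℝ => (1 + ‖x‖^2) ^ (-1:ℝ)) ∘ (fun ξ : Euc n => l * (‖ξ‖^2)^k) := by
        funext ξ
        simp only [Function.comp, Real.norm_eq_abs, sq_abs]
        congr 2
        rw [hk]; ring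
      rw [e]; exact h
    · have hy : (fun ξ : Euc n => (l * (‖ξ‖^2)^k) • ξ).HasTemperateGrowth := by
        have h1 : (fun ξ : Euc n => l * (‖ξ‖^2)^k).HasTemperateGrowth := by fun_prop
        exact h1.smul Function.HasTemperateGrowth.id'
      have h := (Function.hasTemperateGrowth_one_add_norm_sq_rpow (Euc n) (-1)).comp hy
      have e : (fun ξ : Euc n => (1 + l^2 * (‖ξ‖^2)^M) ^ (-1:ℝ)) =
          (fun x : Euc n => (1 + ‖x‖^2) ^ (-1:ℝ)) ∘ (fun ξ : Euc n => (l * (‖ξ‖^2)^k) • ξ) := by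
        funext ξ
        simp only [Function.comp, norm_smul, mul_pow, Real.norm_eq_abs, sq_abs]
        congr 2
        rw [hk]; ring
      rw [e]; exact h
  have h2 : (fun ξ : Euc n => c⁻¹ * (1 + l^2 * (‖ξ‖^2)^M) ^ (-1:ℝ)).HasTemperateGrowth :=
    (Function.HasTemperateGrowth.const c⁻¹).mul main
  convert h2 using 2 with ξ
  rw [Real.rpow_neg_one, hl2, ← mul_inv]
  congr 1
  rw [mul_pow ((2*π)^2)]
  field_simp

lemma sch_lap_re {n : ℕ} (g : 𝓢(Euc n, ℂ)) :
    Δ (g.postcompCLM Complex.reCLM) = (Δ g).postcompCLM Complex.reCLM := by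
  ext x
  rw [SchwartzMap.laplacian_apply, SchwartzMap.postcompCLM_apply, SchwartzMap.laplacian_apply]
  have : ContDiffAt ℝ 2 (g : Euc n → ℂ) x := (g.smooth 2).contDiffAt
  have h := this.laplacian_CLM_comp_left (l := Complex.reCLM)
  exact h

lemma sch_lap_iter_re {n : ℕ} (g : 𝓢(Euc n, ℂ)) (M : ℕ) :
    ((fun ψ : 𝓢(Euc n, ℝ) => Δ ψ)^[M] (g.postcompCLM Complex.reCLM))
      = ((fun ψ : 𝓢(Euc n, ℂ) => Δ ψ)^[M] g).postcompCLM Complex.reCLM := by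
  induction M with
  | zero => rfl
  | succ M ih => rw [Function.iterate_succ_apply', ih, Function.iterate_succ_apply', sch_lap_re]

lemma sch_lap_iter_mult {n : ℕ} (g : 𝓢(Euc n, ℂ)) (M : ℕ) :
    ((fun ψ : 𝓢(Euc n, ℂ) => Δ ψ)^[M] g) = SchwartzMap.fourierMultiplierCLM ℂ
      (fun ξ : Euc n => (-((2*π)^2) * ‖ξ‖^2)^M) g := by
  induction M with
  | zero => 
    simp
  | succ M ih =>
    rw [Function.iterate_succ_apply', ih, SchwartzMap.laplacian_eq_fourierMultiplierCLM]
    have e : (fun ξ : Euc n => (‖ξ‖^2)) = (‖·‖ ^ 2) := rfl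
    rw [SchwartzMap.fourierMultiplierCLM_fourierMultiplierCLM_apply (by fun_prop) (by fun_prop)]
    have := SchwartzMap.fourierMultiplierCLM_smul (F := ℂ) (𝕜 := ℝ)
      (g := (fun x : Euc n => ‖x‖^2) * (fun ξ : Euc n => (-((2*π)^2) * ‖ξ‖^2)^M)) (by fun_prop)
      (-(2*π)^2)
    rw [← smul_apply, ← this]
    congr 2
    funext ξ
    simp only [Pi.smul_apply, Pi.mul_apply, smul_eq_mul]
    ring

abbrev toC {n : ℕ} (φ : 𝓢(Euc n, ℝ)) : 𝓢(Euc n, ℂ) := φ.postcompCLM Complex.ofRealCLM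

lemma inv_op {n : ℕ} (c : ℝ) (hc : 0 < c) (M : ℕ) (φ : 𝓢(Euc n, ℝ)) : ∃ g : 𝓢(Euc n, ℝ),
    (∀ x, c * g x + (-1)^M * ((fun ψ : 𝓢(Euc n, ℝ) => Δ ψ)^[M] g) x = φ x) ∧
    ∫ x, (g x)^2 ≤ ∫ ξ, ‖𝓕 (toC φ) ξ‖^2 * ((c + ((2*π)^2 * ‖ξ‖^2)^M)⁻¹)^2 := by
  set σ := fun ξ : Euc n => (c + ((2*π)^2 * ‖ξ‖^2)^M)⁻¹ with hσ
  have hσt : σ.HasTemperateGrowth := tg_norm_pow c hc M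
  set gc := SchwartzMap.fourierMultiplierCLM ℂ σ (toC φ) with hgc
  refine ⟨gc.postcompCLM Complex.reCLM, ?_, ?_⟩
  · intro x
    have h1 : (c : ℝ) • gc + ((-1:ℝ)^M) • ((fun ψ : 𝓢(Euc n, ℂ) => Δ ψ)^[M] gc) = toC φ := by
      rw [sch_lap_iter_mult, hgc,
        SchwartzMap.fourierMultiplierCLM_fourierMultiplierCLM_apply (by fun_prop) hσt]
      rw [← smul_apply, ← SchwartzMap.fourierMultiplierCLM_smul hσt, ← smul_apply,
        ← SchwartzMap.fourierMultiplierCLM_smul (by fun_prop)]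
      simp only [SchwartzMap.fourierMultiplierCLM_apply]
      rw [← FourierTransform.fourierInv_add, ← add_apply, ← SchwartzMap.smulLeftCLM_add
        (by exact (Function.HasTemperateGrowth.const c).mul hσt) (by
          refine (Function.HasTemperateGrowth.const _).mul ?_
          exact Function.HasTemperateGrowth.mul (by fun_prop) hσt)]
      have : (c • σ + (-1:ℝ)^M • ((fun ξ : Euc n => (-(2*π)^2 * ‖ξ‖^2)^M) * σ)) = fun _ => 1 := by
        funext ξ
        simp only [Pi.add_apply, Pi.smul_apply, Pi.mul_apply, smul_eq_mul, hσ]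
        have : (0:ℝ) < c + ((2*π)^2 * ‖ξ‖^2)^M := by positivity
        rw [neg_mul, neg_pow ((2*π)^2 * ‖ξ‖^2) M]
        field_simp
        rw [← pow_mul, mul_comm M 2, pow_mul]
        norm_num
      rw [this]
      simp
    rw [sch_lap_iter_re]
    have := congrArg (fun f : 𝓢(Euc n, ℂ) => (f x).re) h1
    simp only [SchwartzMap.postcompCLM_apply, add_apply, smul_apply] at this ⊢
    rw [Complex.add_re, Complex.smul_re, Complex.smul_re] at this
    simpa [-Function.iterate_succ] using this
  · have e1 : ∫ ξ, ‖𝓕 (toC φ) ξ‖^2 * (σ ξ)^2 = ∫ x, ‖gc x‖^2 := by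
      rw [← SchwartzMap.integral_norm_sq_fourier gc]
      congr 1; funext ξ
      rw [hgc, SchwartzMap.fourierMultiplierCLM_apply, FourierTransform.fourier_fourierInv_eq,
        SchwartzMap.smulLeftCLM_apply_apply hσt, norm_smul, mul_pow, Real.norm_eq_abs, sq_abs]
      ring
    rw [e1]
    refine integral_mono (((gc.postcompCLM Complex.reCLM).memLp 2).integrable_sq)
      ((gc.memLp 2).norm.integrable_sq) fun x => ?_
    simp only [SchwartzMap.postcompCLM_apply]
    rw [← sq_abs]
    gcongr
    exact Complex.abs_re_le_norm _

end

section
open scoped SchwartzMap LineDeriv Laplacian FourierTransform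

lemma vol_ball_real (m : ℕ) (hm : 1 ≤ m) (r : ℝ) (hr : 0 ≤ r) :
    (volume : Measure (Euc (2*m))).real (Metric.ball 0 r) = r^(2*m) * (π^m / m.factorial) := by
  have : Nontrivial (Euc (2*m)) := by
    have : Nonempty (Fin (2*m)) := ⟨⟨0, by omega⟩⟩
    infer_instance
  have h := InnerProductSpace.volume_ball_of_dim_even (E := Euc (2*m)) (k := m) (by simp) 0 r
  rw [Measure.real, h, ENNReal.toReal_mul, ENNReal.toReal_pow, ENNReal.toReal_ofReal hr,
    ENNReal.toReal_ofReal (by positivity)]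
  simp

lemma annulus_integrable (m : ℕ) (R : ℝ) : Integrable (fun ξ : Euc (2*m) =>
    (Set.Ico 1 R).indicator (fun r : ℝ => (r^(2*m))⁻¹) ‖ξ‖) := by
  have : Integrable ((Metric.ball (0 : Euc (2*m)) R).indicator (fun _ => (1:ℝ))) := by
    rw [integrable_indicator_iff Metric.isOpen_ball.measurableSet]
    exact integrableOn_const (by exact (measure_ball_lt_top).ne)
  refine this.mono' ?_ (Eventually.of_forall fun ξ => ?_)
  · refine Measurable.aestronglyMeasurable ?_
    refine (Measurable.indicator (by fun_prop) measurableSet_Ico).comp measurable_norm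
  · by_cases h : ‖ξ‖ ∈ Set.Ico 1 R
    · rw [Set.indicator_of_mem h, Set.indicator_of_mem (by simpa using h.2)]
      rw [Real.norm_of_nonneg (by positivity)]
      exact inv_le_one_of_one_le₀ (one_le_pow₀ h.1)
    · rw [Set.indicator_of_notMem h]
      simp only [norm_zero]
      exact Set.indicator_nonneg (fun _ _ => zero_le_one) _

lemma annulus_integral (m : ℕ) (hm : 1 ≤ m) (R : ℝ) (hR : 1 ≤ R) : ∫ ξ : Euc (2*m),
    (Set.Ico 1 R).indicator (fun r : ℝ => (r^(2*m))⁻¹) ‖ξ‖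
      = (2*m) * (π^m / m.factorial) * Real.log R := by
  have : Nontrivial (Euc (2*m)) := by
    have : Nonempty (Fin (2*m)) := ⟨⟨0, by omega⟩⟩
    infer_instance
  rw [integral_fun_norm_addHaar (μ := (volume : Measure (Euc (2*m))))
    (fun r : ℝ => (Set.Ico 1 R).indicator (fun r : ℝ => (r^(2*m))⁻¹) r)]
  rw [vol_ball_real m hm 1 zero_le_one]
  have e : ∫ y in Set.Ioi (0:ℝ), y ^ (Module.finrank ℝ (Euc (2*m)) - 1) •
      (Set.Ico 1 R).indicator (fun r : ℝ => (r^(2*m))⁻¹) y = Real.log R := by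
    have e1 : ∀ y : ℝ, y ^ (Module.finrank ℝ (Euc (2*m)) - 1) •
      (Set.Ico 1 R).indicator (fun r : ℝ => (r^(2*m))⁻¹) y
        = (Set.Ico 1 R).indicator (fun r : ℝ => r⁻¹) y := by
      intro y
      by_cases h : y ∈ Set.Ico 1 R
      · rw [Set.indicator_of_mem h, Set.indicator_of_mem h]
        have hy : 0 < y := by linarith [h.1]
        have : 2 * m = (2*m-1) + 1 := by omega
        simp only [finrank_euclideanSpace, Fintype.card_fin, smul_eq_mul]
        rw [show y^(2*m) = y^(2*m-1) * y by rw [← pow_succ]; congr 1]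
        field_simp
      · rw [Set.indicator_of_notMem h, Set.indicator_of_notMem h, smul_zero]
    simp_rw [e1]
    rw [setIntegral_indicator measurableSet_Ico]
    have : Set.Ioi (0:ℝ) ∩ Set.Ico 1 R = Set.Ico 1 R := by
      ext y; simp only [Set.mem_inter_iff, Set.mem_Ioi, Set.mem_Ico]
      constructor
      · exact fun h => h.2
      · exact fun h => ⟨by linarith [h.1], h⟩
    rw [this, integral_Ico_eq_integral_Ioo, ← integral_Ioc_eq_integral_Ioo,
      ← intervalIntegral.integral_of_le hR, integral_inv_of_pos one_pos (by linarith), div_one]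
  rw [e]
  simp [mul_assoc]

lemma freq_bound (m M : ℕ) (hm : 1 ≤ m) (hM : m = 2 * M) (c : ℝ) (hc : 0 < c) :
    ∃ K : ℝ, 0 ≤ K ∧ ∀ φ : 𝓢(Euc (2*m), ℝ), (∀ x, 0 ≤ φ x) → (∀ x, φ x ≤ 1) →
      0 < ∫ x, φ x → ∫ x, φ x ≤ 1 →
      ∫ ξ, ‖𝓕 (toC φ) ξ‖^2 * ((c + ((2*π)^2 * ‖ξ‖^2)^M)⁻¹)^2 ≤
        (∫ x, φ x)^2 * (K + Real.log (1 / ∫ x, φ x) / ((4*π)^m * m.factorial)) := by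
  set V : ℝ := π^m / m.factorial with hV
  set A : ℝ := ((2*π)^(2*m))⁻¹ with hA
  have hA0 : 0 < A := by positivity
  have hV0 : 0 < V := by positivity
  have hVA : V * A = 1 / ((4*π)^m * m.factorial) := by
    rw [hV, hA, pow_mul, mul_pow 2 π 2, mul_pow, mul_pow 4 π]
    norm_num
    field_simp
    ring
  refine ⟨V * (c⁻¹)^2 + A, by positivity, fun φ h0 h1 hs hs1 => ?_⟩
  set s := ∫ x, φ x with hsdef
  set R : ℝ := s ^ (-(1 / (2*m) : ℝ)) with hRdef
  have hm' : (0:ℝ) < m := by exact_mod_cast hm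
  have hR1 : 1 ≤ R := Real.one_le_rpow_of_pos_of_le_one_of_nonpos hs hs1 (by
    have : (0:ℝ) < 1 / (2*m) := by positivity
    linarith)
  have hR0 : 0 < R := by linarith
  have hRp : R^(2*m) = s⁻¹ := by
    rw [hRdef, ← Real.rpow_natCast, ← Real.rpow_mul hs.le]
    rw [show (-(1 / (2*m) : ℝ)) * ((2*m : ℕ) : ℝ) = -1 by push_cast; field_simp]
    exact Real.rpow_neg_one s
  have hlog : (2*m) * Real.log R = Real.log (1/s) := by
    rw [one_div, ← hRp, Real.log_pow]; push_cast; ring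
  have hF : ∀ ξ, ‖𝓕 (toC φ) ξ‖ ≤ s := by
    intro ξ
    refine (SchwartzMap.norm_fourier_apply_le_toLp_one _ _).trans (le_of_eq ?_)
    rw [SchwartzMap.norm_toLp_one]
    congr 1; funext x
    simp [abs_of_nonneg (h0 x)]
  have hF2 : ∫ ξ, ‖𝓕 (toC φ) ξ‖^2 ≤ s := by
    rw [SchwartzMap.integral_norm_sq_fourier]
    refine integral_mono ((toC φ).memLp 2).norm.integrable_sq φ.integrable fun x => ?_
    simp only [SchwartzMap.postcompCLM_apply, Complex.ofRealCLM_apply, Complex.norm_real,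
      Real.norm_eq_abs, sq_abs]
    nlinarith [h0 x, h1 x]
  have hF2i : Integrable (fun ξ => ‖𝓕 (toC φ) ξ‖^2) := ((𝓕 (toC φ)).memLp 2).norm.integrable_sq
  set k1 : Euc (2*m) → ℝ := (Metric.ball (0 : Euc (2*m)) 1).indicator (fun _ => (c⁻¹)^2)
  set k2 : Euc (2*m) → ℝ := fun ξ => (Set.Ico 1 R).indicator (fun r : ℝ => (r^(2*m))⁻¹) ‖ξ‖
  have hk1i : Integrable k1 := by
    rw [integrable_indicator_iff Metric.isOpen_ball.measurableSet]
    exact integrableOn_const (by exact (measure_ball_lt_top).ne)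
  have hk2i : Integrable k2 := annulus_integrable m R
  have hk1 : ∫ ξ, k1 ξ = V * (c⁻¹)^2 := by
    rw [integral_indicator Metric.isOpen_ball.measurableSet, setIntegral_const,
      vol_ball_real m hm 1 zero_le_one]
    simp [hV]
  have hk2 : ∫ ξ, k2 ξ = V * Real.log (1/s) := by
    rw [annulus_integral m hm R hR1, ← hlog]; ring
  have hσ1 : ∀ ξ : Euc (2*m), ((c + ((2*π)^2 * ‖ξ‖^2)^M)⁻¹)^2 ≤ (c⁻¹)^2 := by
    intro ξ
    gcongr
    have : 0 ≤ ((2*π)^2 * ‖ξ‖^2)^M := by positivity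
    linarith
  have hσ2 : ∀ ξ : Euc (2*m), 0 < ‖ξ‖ →
      ((c + ((2*π)^2 * ‖ξ‖^2)^M)⁻¹)^2 ≤ A * (‖ξ‖^(2*m))⁻¹ := by
    intro ξ hξ
    have e : A * (‖ξ‖^(2*m))⁻¹ = (((((2*π)^2 * ‖ξ‖^2)^M))⁻¹)^2 := by
      rw [hA, ← mul_inv, ← mul_pow, inv_pow, ← mul_pow, ← pow_mul, ← pow_mul]
      congr 2; omega
    rw [e]
    gcongr
    linarith
  have pt : ∀ ξ, ‖𝓕 (toC φ) ξ‖^2 * ((c + ((2*π)^2 * ‖ξ‖^2)^M)⁻¹)^2 ≤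
      s^2 * (k1 ξ + A * k2 ξ) + A * s * ‖𝓕 (toC φ) ξ‖^2 := by
    intro ξ
    have hFs : ‖𝓕 (toC φ) ξ‖^2 ≤ s^2 := by gcongr; exact hF ξ
    have hk1n : 0 ≤ k1 ξ := Set.indicator_nonneg (fun _ _ => by positivity) _
    have hk2n : 0 ≤ k2 ξ := Set.indicator_nonneg (fun x hx => by
      have : (0:ℝ) ≤ x := by linarith [hx.1]
      positivity) _
    have last : 0 ≤ A * s * ‖𝓕 (toC φ) ξ‖^2 := by positivity
    rcases lt_or_ge ‖ξ‖ 1 with hlt | hge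
    · have : k1 ξ = (c⁻¹)^2 := Set.indicator_of_mem (by simpa using hlt) _
      calc _ ≤ s^2 * (c⁻¹)^2 := mul_le_mul hFs (hσ1 ξ) (by positivity) (by positivity)
        _ ≤ _ := by rw [← this]; nlinarith [mul_nonneg (sq_nonneg s) (mul_nonneg hA0.le hk2n)]
    · have hξ : 0 < ‖ξ‖ := by linarith
      rcases lt_or_ge ‖ξ‖ R with hlt | hge'
      · have : k2 ξ = (‖ξ‖^(2*m))⁻¹ := Set.indicator_of_mem (s := Set.Ico 1 R) ⟨hge, hlt⟩ _
        calc _ ≤ s^2 * (A * (‖ξ‖^(2*m))⁻¹) := by gcongr; exact hσ2 ξ hξ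
          _ ≤ _ := by rw [← this]; nlinarith [mul_nonneg (sq_nonneg s) hk1n]
      · have h3 : (‖ξ‖^(2*m))⁻¹ ≤ s := by
          rw [inv_le_comm₀ (by positivity) hs, ← hRp]; gcongr
        calc _ ≤ ‖𝓕 (toC φ) ξ‖^2 * (A * s) := by
              gcongr; exact (hσ2 ξ hξ).trans (by gcongr)
          _ ≤ _ := by
            have : 0 ≤ s^2 * (k1 ξ + A * k2 ξ) := by positivity
            linarith
  have hint : Integrable (fun ξ => s^2 * (k1 ξ + A * k2 ξ)) :=
    (hk1i.add (hk2i.const_mul A)).const_mul _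
  have hint2 : Integrable (fun ξ => A * s * ‖𝓕 (toC φ) ξ‖^2) := hF2i.const_mul _
  calc _ ≤ ∫ ξ, (s^2 * (k1 ξ + A * k2 ξ) + A * s * ‖𝓕 (toC φ) ξ‖^2) := by
        refine integral_mono_of_nonneg (Eventually.of_forall fun ξ => by positivity)
          (hint.add hint2) (Eventually.of_forall pt)
    _ = s^2 * (V * (c⁻¹)^2 + A * (V * Real.log (1/s))) + A * s * ∫ ξ, ‖𝓕 (toC φ) ξ‖^2 := by
        rw [integral_add hint hint2, integral_const_mul, integral_const_mul,
          integral_add hk1i (hk2i.const_mul A), integral_const_mul, hk1, hk2]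
    _ ≤ s^2 * (V * (c⁻¹)^2 + A * (V * Real.log (1/s))) + A * s * s := by gcongr
    _ = _ := by
      rw [div_eq_mul_one_div (Real.log (1/s)) ((4*π)^m * (m.factorial:ℝ)), ← hVA]; ring

end

section
open scoped SchwartzMap LineDeriv Laplacian FourierTransform

lemma cs_int {n : ℕ} {f g : Euc n → ℝ} (hf : MemLp f 2) (hg : MemLp g 2) :
    (∫ x, f x * g x)^2 ≤ (∫ x, (f x)^2) * ∫ x, (g x)^2 := by
  have i1 : Integrable (fun x => f x * g x) := hf.integrable_mul hg
  have i2 := hf.integrable_sq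
  have i3 := hg.integrable_sq
  have key : ∀ l : ℝ, 0 ≤ (∫ x, (g x)^2) * (l * l) + (-2 * ∫ x, f x * g x) * l + ∫ x, (f x)^2 := by
    intro l
    have : 0 ≤ ∫ x, (f x - l * g x)^2 := integral_nonneg fun x => sq_nonneg _
    have e : ∫ x, (f x - l * g x)^2 =
        (∫ x, (f x)^2) - 2 * l * (∫ x, f x * g x) + l^2 * ∫ x, (g x)^2 := by
      rw [← integral_const_mul, ← integral_const_mul, ← integral_sub i2 (i1.const_mul _),
        ← integral_add (f := fun x => (f x)^2 - 2 * l * (f x * g x)) (i2.sub (i1.const_mul _))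
          (i3.const_mul _)]
      congr 1; funext x; ring
    rw [e] at this
    linarith
  have := discrim_le_zero key
  unfold discrim at this
  nlinarith

lemma bump_ex {n : ℕ} {K A : Set (Euc n)} (hK : IsCompact K) (hA : IsOpen A) (hKA : K ⊆ A) :
    ∃ φ : 𝓢(Euc n, ℝ), (∀ x, 0 ≤ φ x) ∧ (∀ x, φ x ≤ 1) ∧ (∀ x ∈ K, φ x = 1) ∧
      (∀ x, x ∉ A → φ x = 0) := by
  obtain ⟨L, hL, h1, h2⟩ := exists_compact_between hK hA hKA
  obtain ⟨f, hf0, hf1, hf⟩ := exists_contMDiffMap_zero_one_of_isClosed (n := ⊤)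
    (modelWithCornersSelf ℝ (Euc n))
    (s := (interior L)ᶜ) (t := K) isOpen_interior.isClosed_compl hK.isClosed
    (by rw [Set.disjoint_compl_left_iff_subset]; exact h1)
  have hs : HasCompactSupport f := by
    refine HasCompactSupport.of_support_subset_isCompact hL fun x hx => ?_
    by_contra hxL
    exact hx (hf0 (fun h => hxL (interior_subset h)))
  have hcd : ContDiff ℝ (⊤ : ℕ∞) f := f.contMDiff.contDiff
  refine ⟨hs.toSchwartzMap hcd, fun x => (hf x).1, fun x => (hf x).2, fun x hx => hf1 hx,
    fun x hx => hf0 (fun h => hx (h2 (interior_subset h)))⟩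

lemma level_set (m M : ℕ) (hm : 1 ≤ m) (hM : m = 2 * M) (c : ℝ) (hc : 0 < c) :
    ∃ K : ℝ, 0 ≤ K ∧ ∀ u : Euc (2*m) → ℝ, ContDiff ℝ (⊤ : ℕ∞) u →
      (∀ j ≤ M, MemLp (lapIter (2*m) j u) 2) → ∀ N : ℝ, 0 < N →
      ∫ x, (c * u x + (-1)^M * lapIter (2*m) M u x)^2 ≤ N^2 → ∀ t : ℝ, 0 < t →
      ∫ x, (u x)^2 ≤ t^2 →
      volume {x | t < u x} ≤ ENNReal.ofReal (K * Real.exp (-(((4*π)^m * m.factorial) * t^2 / N^2))) := by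
  obtain ⟨K, hK0, hK⟩ := freq_bound m M hm hM c hc
  set α : ℝ := (4*π)^m * m.factorial with hα
  have hα0 : 0 < α := by positivity
  refine ⟨Real.exp (α * K), by positivity, fun u hu h2 N hN hP t ht htu => ?_⟩
  have hu2 : MemLp u 2 := h2 0 (Nat.zero_le _)
  have hA : IsOpen {x | t < u x} := isOpen_lt continuous_const hu.continuous
  have ht2 : 0 < t^2 := by positivity
  have hvol : (volume {x | t < u x}) ≤ 1 := by
    have hi := hu2.integrable_sq
    have ch := mul_meas_ge_le_lintegral₀ (μ := volume)
      (f := fun x => ENNReal.ofReal ((u x)^2))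
      (by
        have : Continuous (fun x => (u x)^2) := hu.continuous.pow 2
        exact Continuous.aemeasurable (ENNReal.continuous_ofReal.comp this)) (ENNReal.ofReal (t^2))
    rw [← ofReal_integral_eq_lintegral_ofReal hi (Eventually.of_forall fun x => sq_nonneg _)] at ch
    have ch2 := ch.trans (ENNReal.ofReal_le_ofReal htu)
    have h0 : ENNReal.ofReal (t^2) ≠ 0 := by simpa using ht.ne'
    have : volume {x | t < u x} ≤ volume {x | ENNReal.ofReal (t^2) ≤ ENNReal.ofReal ((u x)^2)} := by
      refine measure_mono fun x hx => ?_
      change t < u x at hx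
      change ENNReal.ofReal (t^2) ≤ ENNReal.ofReal ((u x)^2)
      apply ENNReal.ofReal_le_ofReal; gcongr
    refine this.trans ?_
    by_contra hcon
    push Not at hcon
    have := ENNReal.mul_lt_mul_right h0 ENNReal.ofReal_ne_top hcon
    rw [mul_one] at this
    exact absurd ch2 (not_le.2 this)
  rw [hA.measure_eq_iSup_isCompact]
  refine iSup₂_le fun K' hK' => iSup_le fun hK'c => ?_
  obtain ⟨φ, f0, f1, fK, fA⟩ := bump_ex hK'c hA hK'
  set s := ∫ x, φ x with hs
  have hA1 : volume.real {x | t < u x} ≤ 1 := by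
    have := ENNReal.toReal_mono ENNReal.one_ne_top hvol
    simpa [measureReal_def] using this
  have hAtop : volume {x | t < u x} ≠ ⊤ := ne_top_of_le_ne_top ENNReal.one_ne_top hvol
  have hs1 : s ≤ 1 := by
    refine le_trans ?_ hA1
    rw [← integral_indicator_one hA.measurableSet]
    refine integral_mono φ.integrable
      ((integrable_indicator_iff hA.measurableSet).2 (integrableOn_const hAtop)) fun x => ?_
    by_cases hx : x ∈ {x | t < u x}
    · rw [Set.indicator_of_mem hx]; exact f1 x
    · rw [Set.indicator_of_notMem hx]; exact (fA x hx).le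
  have hK'f : volume K' ≠ ⊤ := hK'c.measure_ne_top
  have hKs : volume.real K' ≤ s := by
    rw [← integral_indicator_one hK'c.measurableSet]
    refine integral_mono 
      ((integrable_indicator_iff hK'c.measurableSet).2 (integrableOn_const hK'f)) φ.integrable
      fun x => ?_
    by_cases hx : x ∈ K'
    · rw [Set.indicator_of_mem hx, fK x hx]; rfl
    · rw [Set.indicator_of_notMem hx]; exact f0 x
  rw [← ENNReal.ofReal_toReal hK'f]
  apply ENNReal.ofReal_le_ofReal
  refine le_trans hKs ?_
  have hs0 : 0 ≤ s := integral_nonneg f0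
  rcases hs0.eq_or_lt with h | hspos
  · rw [← h]; positivity
  obtain ⟨g, hg, hg2⟩ := inv_op c hc M φ
  have hφ := hK φ f0 f1 hspos hs1
  have hg3 := hg2.trans hφ
  have hgL : MemLp g 2 := g.memLp 2
  set G := ((fun ψ : 𝓢(Euc (2*m), ℝ) => Δ ψ)^[M] g) with hG
  have iug : Integrable (fun x => u x * g x) := hu2.integrable_mul hgL
  have iuG : Integrable (fun x => u x * G x) := hu2.integrable_mul (G.memLp 2)
  have iLg : Integrable (fun x => lapIter (2*m) M u x * g x) := (h2 M le_rfl).integrable_mul hgL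
  have e1 : ∫ x, u x * φ x = ∫ x, (c * u x + (-1)^M * lapIter (2*m) M u x) * g x := by
    have ea : ∫ x, u x * φ x = c * (∫ x, u x * g x) + (-1)^M * ∫ x, u x * G x := by
      rw [← integral_const_mul, ← integral_const_mul,
        ← integral_add (iug.const_mul _) (iuG.const_mul _)]
      congr 1; funext x; rw [← hg x]; ring
    rw [ea, hG, ibp_iter hu M h2 g, ← integral_const_mul, ← integral_const_mul,
        ← integral_add (iug.const_mul _) (iLg.const_mul _)]
    congr 1; funext x; ring
  have e2 : t * s ≤ ∫ x, u x * φ x := by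
    rw [hs, ← integral_const_mul]
    refine integral_mono (φ.integrable.const_mul _) (hu2.integrable_mul (φ.memLp 2)) fun x => ?_
    by_cases hx : x ∈ {x | t < u x}
    · exact mul_le_mul_of_nonneg_right (le_of_lt hx) (f0 x)
    · simp [fA x hx]
  have hPL : MemLp (fun x => c * u x + (-1)^M * lapIter (2*m) M u x) 2 :=
    (hu2.const_mul c).add ((h2 M le_rfl).const_mul _)
  have hCS := cs_int hPL hgL
  rw [← e1] at hCS
  have e3 : (t*s)^2 ≤ (∫ x, u x * φ x)^2 := by
    have : 0 ≤ t * s := by positivity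
    gcongr
  have e4 : (t*s)^2 ≤ N^2 * (s^2 * (K + Real.log (1/s) / α)) := by
    refine e3.trans (hCS.trans ?_)
    refine mul_le_mul hP hg3 (integral_nonneg fun x => sq_nonneg _) (by positivity)
  have e5 : t^2 ≤ N^2 * (K + Real.log (1/s) / α) := by
    have h3 : s^2 * t^2 ≤ s^2 * (N^2 * (K + Real.log (1/s) / α)) := by nlinarith
    exact le_of_mul_le_mul_left h3 (by positivity)
  have e6 : Real.log s ≤ α * K - α * t^2 / N^2 := by
    rw [one_div, Real.log_inv] at e5
    have : t^2 / N^2 ≤ K + -Real.log s / α := by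
      rw [div_le_iff₀ (by positivity)]; linarith
    have := mul_le_mul_of_nonneg_left this hα0.le
    have e : α * (K + -Real.log s / α) = α * K - Real.log s := by field_simp; ring
    rw [e, ← mul_div_assoc] at this
    linarith
  rw [← Real.exp_add]
  calc s = Real.exp (Real.log s) := (Real.exp_log hspos).symm
    _ ≤ _ := by apply Real.exp_le_exp.2; linarith

end

section
/-- Lebesgue measure with the singular weight. -/
def wt (n : ℕ) (β : ℝ) : Measure (Euc n) :=
  volume.withDensity (fun x => ENNReal.ofReal ((‖x‖^β)⁻¹))

lemma wt_meas (n : ℕ) (β : ℝ) : Measurable (fun x : Euc n => (‖x‖^β)⁻¹) :=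
  ((measurable_norm).pow_const β).inv

lemma wt_ball (n : ℕ) (hn : 1 ≤ n) (β : ℝ) (hβ : β < n) :
    ∃ C : ℝ, 0 ≤ C ∧ ∀ ρ : ℝ, 0 < ρ →
      wt n β (Metric.ball 0 ρ) = ENNReal.ofReal (ρ ^ ((n:ℝ) - β) * C) := by
  set J : Euc n → ℝ := (Metric.ball (0 : Euc n) 1).indicator (fun x => (‖x‖^β)⁻¹) with hJ
  have hJi : Integrable J := by
    rw [hJ, integrable_indicator_iff Metric.isOpen_ball.measurableSet]
    refine integrableOn_ball_of_norm_le_rpow (C := 1) (α := β) (by simpa using hn)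
      (by simpa using hβ) (Eventually.of_forall fun x => ?_) (wt_meas n β).aestronglyMeasurable
    rw [Real.norm_of_nonneg (by positivity), one_mul, Real.rpow_neg (norm_nonneg _)]
  have hJ0 : ∀ x, 0 ≤ J x := fun x => Set.indicator_nonneg (fun _ _ => by positivity) _
  refine ⟨∫ x, J x, integral_nonneg hJ0, fun ρ hρ => ?_⟩
  have e : ∀ x, (Metric.ball (0 : Euc n) ρ).indicator (fun x => (‖x‖^β)⁻¹) x =
      (ρ^β)⁻¹ * J (ρ⁻¹ • x) := by
    intro x
    have hb : ρ⁻¹ • x ∈ Metric.ball (0 : Euc n) 1 ↔ x ∈ Metric.ball (0 : Euc n) ρ := by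
      simp only [Metric.mem_ball, dist_zero_right, norm_smul, norm_inv, Real.norm_eq_abs,
        abs_of_pos hρ]
      rw [inv_mul_lt_iff₀ hρ, mul_one]
    by_cases hx : x ∈ Metric.ball (0 : Euc n) ρ
    · rw [hJ, Set.indicator_of_mem hx, Set.indicator_of_mem (hb.2 hx), ← mul_inv, norm_smul,
        ← Real.mul_rpow hρ.le (by positivity), norm_inv, Real.norm_eq_abs, abs_of_pos hρ,
        mul_inv_cancel_left₀ hρ.ne']
    · rw [hJ, Set.indicator_of_notMem hx, Set.indicator_of_notMem (fun h => hx (hb.1 h)), mul_zero]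
  have hi : Integrable (fun x => (ρ^β)⁻¹ * J (ρ⁻¹ • x)) :=
    (hJi.comp_smul (inv_ne_zero hρ.ne')).const_mul _
  rw [wt, withDensity_apply _ Metric.isOpen_ball.measurableSet,
    ← lintegral_indicator Metric.isOpen_ball.measurableSet]
  have e2 : ∀ x, (Metric.ball (0 : Euc n) ρ).indicator
      (fun x => ENNReal.ofReal ((‖x‖^β)⁻¹)) x = ENNReal.ofReal ((ρ^β)⁻¹ * J (ρ⁻¹ • x)) := by
    intro x
    rw [← e]
    by_cases hx : x ∈ Metric.ball (0 : Euc n) ρ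
    · rw [Set.indicator_of_mem hx, Set.indicator_of_mem hx]
    · rw [Set.indicator_of_notMem hx, Set.indicator_of_notMem hx, ENNReal.ofReal_zero]
  simp_rw [e2]
  rw [← ofReal_integral_eq_lintegral_ofReal hi
    (Eventually.of_forall fun x => mul_nonneg (by positivity) (hJ0 _)), integral_const_mul,
    Measure.integral_comp_smul_of_nonneg _ _ _ (hR := by positivity)]
  congr 1
  rw [finrank_euclideanSpace, Fintype.card_fin, Real.rpow_sub hρ, Real.rpow_natCast, smul_eq_mul,
    inv_pow, inv_inv]
  field_simp

lemma wt_le (n : ℕ) (hn : 1 ≤ n) (β : ℝ) (hβ0 : 0 ≤ β) (hβ : β < n) :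
    ∃ C : ℝ, 0 ≤ C ∧ ∀ (A : Set (Euc n)) (V : ℝ), 0 < V → MeasurableSet A →
      volume A ≤ ENNReal.ofReal V → wt n β A ≤ ENNReal.ofReal (C * V ^ (1 - β / n)) := by
  obtain ⟨C, hC, h⟩ := wt_ball n hn β hβ
  have hn' : (0:ℝ) < n := by exact_mod_cast hn
  refine ⟨C + 1, by positivity, fun A V hV hA hAV => ?_⟩
  set ρ := V ^ (1 / (n:ℝ)) with hρd
  have hρ : 0 < ρ := by positivity
  have e1 : ρ ^ ((n:ℝ) - β) = V ^ (1 - β/n) := by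
    rw [hρd, ← Real.rpow_mul hV.le]; congr 1; field_simp
  have e2 : (ρ ^ β)⁻¹ * V = V ^ (1 - β/n) := by
    rw [hρd, ← Real.rpow_mul hV.le, Real.rpow_sub hV, Real.rpow_one, one_div_mul_eq_div]
    field_simp
  have hsub : A ⊆ Metric.ball 0 ρ ∪ (A \ Metric.ball 0 ρ) := fun x hx => by
    by_cases hb : x ∈ Metric.ball (0 : Euc n) ρ
    · exact Or.inl hb
    · exact Or.inr ⟨hx, hb⟩
  have hD : MeasurableSet (A \ Metric.ball (0 : Euc n) ρ) :=
    hA.diff Metric.isOpen_ball.measurableSet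
  have b2 : wt n β (A \ Metric.ball 0 ρ) ≤ ENNReal.ofReal (V ^ (1 - β/n)) := by
    rw [wt, withDensity_apply _ hD]
    calc _ ≤ ∫⁻ x in A \ Metric.ball 0 ρ, ENNReal.ofReal ((ρ^β)⁻¹) := by
          refine setLIntegral_mono measurable_const fun x hx => ?_
          apply ENNReal.ofReal_le_ofReal
          have : ρ ≤ ‖x‖ := by simpa using hx.2
          gcongr
      _ ≤ ENNReal.ofReal ((ρ^β)⁻¹) * ENNReal.ofReal V := by
          rw [setLIntegral_const]
          gcongr
          exact (measure_mono Set.sdiff_subset).trans hAV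
      _ = _ := by rw [← ENNReal.ofReal_mul (by positivity), e2]
  calc wt n β A ≤ wt n β (Metric.ball 0 ρ ∪ (A \ Metric.ball 0 ρ)) := measure_mono hsub
    _ ≤ wt n β (Metric.ball 0 ρ) + wt n β (A \ Metric.ball 0 ρ) := measure_union_le _ _
    _ ≤ ENNReal.ofReal (V ^ (1 - β/n) * C) + ENNReal.ofReal (V ^ (1 - β/n)) := by
        rw [h ρ hρ, e1]; gcongr
    _ = _ := by
        rw [← ENNReal.ofReal_add (by positivity) (by positivity)]; congr 1; ring

lemma final_int (n : ℕ) (hn : 1 ≤ n) (β : ℝ) (hβ0 : 0 ≤ β) (hβ : β < n)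
    (p q C τ B : ℝ) (hp : 0 < p) (hpq : p < q) (hC : 0 ≤ C) (hτ : 0 ≤ τ) :
    ∃ C' : ℝ, ∀ w : Euc n → ℝ, Continuous w → Integrable (fun x => (w x)^2) →
      ∫ x, (w x)^2 ≤ B →
      (∀ s, τ ≤ s → wt n β {x | s < (w x)^2} ≤ ENNReal.ofReal (C * Real.exp (-(q * s)))) →
      ∫ x, (Real.exp (p * (w x)^2) - 1) / ‖x‖ ^ β ≤ C' := by
  obtain ⟨C1, hC1, hball⟩ := wt_ball n hn β hβ
  set r := Real.exp (-(q-p)) with hr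
  have hr1 : r < 1 := by rw [hr, Real.exp_lt_one_iff]; linarith
  have hr0 : 0 < r := Real.exp_pos _
  set D := C * Real.exp (p * (τ + 1) - q * τ) with hD
  have hD0 : 0 ≤ D := by positivity
  -- the total bound
  set T : ENNReal := ENNReal.ofReal (p * Real.exp (p * τ)) *
      (ENNReal.ofReal τ * wt n β (Metric.ball 0 1) + ENNReal.ofReal B) +
      ENNReal.ofReal (∑' j : ℕ, D * r^j) with hT
  have hTtop : T ≠ ⊤ := by
    rw [hT, hball 1 one_pos]
    exact ENNReal.add_ne_top.2 ⟨ENNReal.mul_ne_top ENNReal.ofReal_ne_top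
      (ENNReal.add_ne_top.2 ⟨ENNReal.mul_ne_top ENNReal.ofReal_ne_top ENNReal.ofReal_ne_top,
        ENNReal.ofReal_ne_top⟩), ENNReal.ofReal_ne_top⟩
  refine ⟨T.toReal, fun w hw hwi hwB hlev => ?_⟩
  have hwm : Measurable w := hw.measurable
  have hpos : ∀ x, 0 ≤ Real.exp (p * (w x)^2) - 1 := fun x => by
    have : 0 ≤ p * (w x)^2 := by positivity
    linarith [Real.add_one_le_exp (p * (w x)^2)]
  rw [integral_eq_lintegral_of_nonneg_ae
    (Eventually.of_forall fun x => div_nonneg (hpos x) (by positivity))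
    (Measurable.aestronglyMeasurable (by
      have := wt_meas n β
      simp_rw [div_eq_mul_inv]
      fun_prop))]
  refine ENNReal.toReal_mono hTtop ?_
  have e1 : ∫⁻ x, ENNReal.ofReal ((Real.exp (p * (w x)^2) - 1) / ‖x‖ ^ β) =
      ∫⁻ x, ENNReal.ofReal (Real.exp (p * (w x)^2) - 1) ∂(wt n β) := by
    rw [wt, lintegral_withDensity_eq_lintegral_mul _ (wt_meas n β).ennreal_ofReal (by fun_prop)]
    congr 1; funext x
    rw [Pi.mul_apply, ← ENNReal.ofReal_mul (by positivity), div_eq_mul_inv, mul_comm]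
  rw [e1]
  set k0 : Euc n → ENNReal := fun x => ENNReal.ofReal (p * Real.exp (p * τ)) *
    (ENNReal.ofReal τ * (Metric.ball (0 : Euc n) 1).indicator 1 x +
      (Metric.ball (0 : Euc n) 1)ᶜ.indicator (fun x => ENNReal.ofReal ((w x)^2)) x) with hk0
  set kj : ℕ → Euc n → ENNReal := fun j x => ENNReal.ofReal (Real.exp (p * (τ + j + 1))) *
    {x | τ + j < (w x)^2}.indicator 1 x with hkj
  have hSm : ∀ j : ℕ, MeasurableSet {x | τ + j < (w x)^2} := fun j =>
    measurableSet_lt measurable_const (by fun_prop)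
  have hkjm : ∀ j, Measurable (kj j) := fun j =>
    measurable_const.mul (measurable_one.indicator (hSm j))
  have mB : MeasurableSet (Metric.ball (0 : Euc n) 1) := Metric.isOpen_ball.measurableSet
  have hk0m : Measurable k0 :=
    measurable_const.mul ((measurable_const.mul (measurable_one.indicator mB)).add
      (Measurable.indicator (by fun_prop) mB.compl))
  have pt : ∀ x, ENNReal.ofReal (Real.exp (p * (w x)^2) - 1) ≤ k0 x + ∑' j, kj j x := by
    intro x
    rcases le_or_gt ((w x)^2) τ with hle | hgt
    · refine le_trans ?_ le_self_add
      have h1 : Real.exp (p * (w x)^2) - 1 ≤ p * Real.exp (p * τ) * (w x)^2 := by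
        have a1 : 1 - p * (w x)^2 ≤ Real.exp (-(p * (w x)^2)) := by
          linarith [Real.add_one_le_exp (-(p * (w x)^2))]
        have a2 : Real.exp (p * (w x)^2) ≤ Real.exp (p * τ) := by gcongr
        have a3 : Real.exp (p * (w x)^2) * (1 - p * (w x)^2) ≤ 1 := by
          calc _ ≤ Real.exp (p * (w x)^2) * Real.exp (-(p * (w x)^2)) := by gcongr
            _ = 1 := by rw [← Real.exp_add]; simp
        have a4 : p * (w x)^2 * Real.exp (p * (w x)^2) ≤ p * (w x)^2 * Real.exp (p * τ) := by
          gcongr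
        nlinarith
      refine (ENNReal.ofReal_le_ofReal h1).trans ?_
      rw [ENNReal.ofReal_mul (by positivity), hk0]
      dsimp only
      gcongr
      by_cases hx : x ∈ Metric.ball (0 : Euc n) 1
      · rw [Set.indicator_of_mem hx, Pi.one_apply, mul_one]
        exact le_trans (ENNReal.ofReal_le_ofReal hle) le_self_add
      · rw [Set.indicator_of_mem (s := (Metric.ball (0 : Euc n) 1)ᶜ) hx]
        exact le_add_self
    · refine le_trans ?_ le_add_self
      obtain ⟨j, hj⟩ : ∃ j : ℕ, j + 1 = ⌈(w x)^2 - τ⌉₊ := by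
        have : 0 < ⌈(w x)^2 - τ⌉₊ := Nat.ceil_pos.2 (by linarith)
        exact ⟨⌈(w x)^2 - τ⌉₊ - 1, by omega⟩
      have hj1 : (w x)^2 ≤ τ + j + 1 := by
        have := Nat.le_ceil ((w x)^2 - τ)
        rw [← hj] at this; push_cast at this; linarith
      have hj2 : τ + j < (w x)^2 := by
        have : j < ⌈(w x)^2 - τ⌉₊ := by omega
        have := Nat.lt_ceil.1 this
        linarith
      refine le_trans ?_ (ENNReal.le_tsum j)
      rw [hkj]
      dsimp only
      rw [Set.indicator_of_mem (show x ∈ {x | τ + j < (w x)^2} from hj2), Pi.one_apply, mul_one]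
      apply ENNReal.ofReal_le_ofReal
      have : Real.exp (p * (w x)^2) ≤ Real.exp (p * (τ + j + 1)) := by gcongr
      linarith
  calc _ ≤ ∫⁻ x, (k0 x + ∑' j, kj j x) ∂(wt n β) := lintegral_mono pt
    _ = ∫⁻ x, k0 x ∂(wt n β) + ∑' j, ∫⁻ x, kj j x ∂(wt n β) := by
        rw [lintegral_add_left hk0m, lintegral_tsum (fun j => (hkjm j).aemeasurable)]
    _ ≤ T := by
      rw [hT]
      refine add_le_add ?_ ?_
      · rw [hk0, lintegral_const_mul' _ _ ENNReal.ofReal_ne_top]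
        gcongr
        rw [lintegral_add_left (f := fun a => ENNReal.ofReal τ * (Metric.ball (0 : Euc n) 1).indicator 1 a)
          (measurable_const.mul (measurable_one.indicator mB)),
          lintegral_const_mul' _ _ ENNReal.ofReal_ne_top, lintegral_indicator_one mB]
        gcongr
        rw [lintegral_indicator mB.compl, wt, setLIntegral_withDensity_eq_setLIntegral_mul _
          (wt_meas n β).ennreal_ofReal (by fun_prop) mB.compl]
        calc _ ≤ ∫⁻ x in (Metric.ball (0 : Euc n) 1)ᶜ, ENNReal.ofReal ((w x)^2) := by
              refine setLIntegral_mono (by fun_prop) fun x hx => ?_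
              rw [Pi.mul_apply]
              have hx1 : 1 ≤ ‖x‖ := by simpa using hx
              have : (‖x‖^β)⁻¹ ≤ 1 := inv_le_one_of_one_le₀ (Real.one_le_rpow hx1 hβ0)
              calc _ ≤ 1 * ENNReal.ofReal ((w x)^2) := by
                    gcongr
                    exact ENNReal.ofReal_le_one.2 this
                _ = _ := one_mul _
          _ ≤ ∫⁻ x, ENNReal.ofReal ((w x)^2) := setLIntegral_le_lintegral _ _
          _ = ENNReal.ofReal (∫ x, (w x)^2) := (ofReal_integral_eq_lintegral_ofReal hwi
              (Eventually.of_forall fun x => sq_nonneg _)).symm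
          _ ≤ _ := ENNReal.ofReal_le_ofReal hwB
      · rw [ENNReal.ofReal_tsum_of_nonneg (fun j => by positivity)
          ((summable_geometric_of_lt_one hr0.le hr1).mul_left D)]
        refine ENNReal.tsum_le_tsum fun j => ?_
        rw [hkj, lintegral_const_mul' _ _ ENNReal.ofReal_ne_top, lintegral_indicator_one (hSm j)]
        refine (mul_le_mul_right (hlev (τ + j) (by linarith [Nat.cast_nonneg (α := ℝ) j])) _).trans ?_
        rw [← ENNReal.ofReal_mul (by positivity)]
        apply ENNReal.ofReal_le_ofReal
        rw [hD, hr, ← Real.exp_nat_mul, mul_left_comm, ← Real.exp_add, mul_assoc, ← Real.exp_add]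
        apply le_of_eq
        congr 2; ring

end

section
lemma lapIter_neg {n : ℕ} {u : Euc n → ℝ} (hu : ContDiff ℝ (⊤ : ℕ∞) u) (k : ℕ) :
    lapIter n k (fun x => - u x) = fun x => - lapIter n k u x := by
  have h0 : ContDiff ℝ (⊤ : ℕ∞) (fun _ : Euc n => (0:ℝ)) := contDiff_const
  have hz : lapIter n k (fun _ => 0) = fun _ => 0 := by
    have := lapIter_sub h0 h0 k
    simpa using this
  have := lapIter_sub h0 hu k
  rw [hz] at this
  simpa using this

set_option maxHeartbeats 1000000 in
lemma combine (m M : ℕ) (hm : 1 ≤ m) (hM : m = 2 * M) (c : ℝ) (hc : 0 < c)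
    (β : ℝ) (hβ0 : 0 ≤ β) (hβ : β < 2*m) (p N H B B' : ℝ) (hp : 0 < p) (hN : 0 < N) (hH : 0 ≤ H)
    (hpN : p * N^2 < (1 - β / (2*m)) * ((4*π)^m * (m.factorial : ℝ))) :
    ∃ C' : ℝ, ∀ w u : Euc (2*m) → ℝ, Continuous w → ContDiff ℝ (⊤ : ℕ∞) u →
      (∀ j ≤ M, MemLp (lapIter (2*m) j u) 2) →
      ∫ x, (c * u x + (-1)^M * lapIter (2*m) M u x)^2 ≤ N^2 →
      ∫ x, (u x)^2 ≤ B' → (∀ x, |w x| ≤ |u x| + H) →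
      Integrable (fun x => (w x)^2) → ∫ x, (w x)^2 ≤ B →
      ∫ x, (Real.exp (p * (w x)^2) - 1) / ‖x‖ ^ β ≤ C' := by
  obtain ⟨K, hK0, hK⟩ := level_set m M hm hM c hc
  have hm' : (0:ℝ) < m := by exact_mod_cast hm
  obtain ⟨C, hC0, hC⟩ := wt_le (2*m) (by omega) β hβ0 (by push_cast; exact hβ)
  set α : ℝ := (4*π)^m * m.factorial with hα
  have hα0 : 0 < α := by positivity
  set θ : ℝ := 1 - β / (2*m) with hθ
  have hθ0 : 0 < θ := by
    rw [hθ, sub_pos, div_lt_one (by positivity)]; exact hβ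
  have hN2 : 0 < N^2 := by positivity
  obtain ⟨q1, hq1, hq2⟩ : ∃ q1, p / θ < q1 ∧ q1 < α / N^2 := by
    apply exists_between
    rw [div_lt_div_iff₀ hθ0 hN2]; linarith
  have hq10 : 0 < q1 := lt_trans (by positivity) hq1
  set δ := 1 - q1 / (α / N^2) with hδ
  have hδ0 : 0 < δ := by
    rw [hδ, sub_pos, div_lt_one (by positivity)]; exact hq2
  have hq1e : (1 - δ) * (α / N^2) = q1 := by
    rw [hδ]; field_simp; ring
  set E := (α / N^2) * ((1/δ - 1) * H^2) with hE
  set t1 := Real.sqrt B' + 1 with ht1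
  have ht10 : 0 < t1 := by positivity
  have ht1B : B' ≤ t1^2 := by
    rcases le_or_gt 0 B' with h | h
    · have := Real.sq_sqrt h
      nlinarith [Real.sqrt_nonneg B']
    · linarith [sq_nonneg t1]
  set V0 := 2 * (K+1) * Real.exp E with hV0
  have hV00 : 0 < V0 := by positivity
  obtain ⟨C', hC'⟩ := final_int (2*m) (by omega) β hβ0 (by push_cast; exact hβ) p (q1 * θ)
    (C * V0 ^ θ) ((t1 + H)^2) B hp (by rwa [div_lt_iff₀ hθ0] at hq1) (by positivity) (by positivity)
  refine ⟨C', fun w u hw hu h2 hP hu2 hwu hwi hwB => hC' w hw hwi hwB fun s hs => ?_⟩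
  have hs0 : 0 ≤ s := le_trans (sq_nonneg _) hs
  have hsq : t1 + H ≤ Real.sqrt s := by
    rw [Real.le_sqrt (by positivity) hs0]; exact hs
  set t := Real.sqrt s - H with ht
  have htt : t1 ≤ t := by linarith
  have ht0 : 0 < t := by linarith
  have hut : ∫ x, (u x)^2 ≤ t^2 := hu2.trans (ht1B.trans (by gcongr))
  have b1 := hK u hu h2 N hN hP t ht0 hut
  have b2 := hK (fun x => - u x) hu.neg (fun j hj => by
      rw [lapIter_neg hu]; exact (h2 j hj).neg) N hN (by
      rw [lapIter_neg hu]
      refine le_trans (le_of_eq ?_) hP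
      congr 1; funext x; ring) t ht0 (by simpa using hut)
  have hexp : Real.exp (-(α * t^2 / N^2)) ≤ Real.exp E * Real.exp (-(q1 * s)) := by
    rw [← Real.exp_add]
    apply Real.exp_le_exp.2
    have h1 : (1 - δ) * s - (1/δ - 1) * H^2 ≤ t^2 := by
      have hss := Real.sq_sqrt hs0
      set a := Real.sqrt s
      rw [ht, ← hss]
      have : 0 ≤ (δ * a - H)^2 / δ := by positivity
      have e : (δ * a - H)^2 / δ = δ * a^2 - 2 * a * H + 1/δ * H^2 := by field_simp; ring
      rw [e] at this
      nlinarith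
    have h2 := mul_le_mul_of_nonneg_left h1 (show 0 ≤ α / N^2 by positivity)
    have e : α / N^2 * ((1 - δ) * s - (1/δ - 1) * H^2) = q1 * s - E := by
      rw [hE, ← hq1e]; ring
    rw [e] at h2
    have e2 : α * t^2 / N^2 = α / N^2 * t^2 := by ring
    rw [e2]; linarith
  have hvol : volume {x | s < (w x)^2} ≤ ENNReal.ofReal (V0 * Real.exp (-(q1 * s))) := by
    have hsub : {x | s < (w x)^2} ⊆ {x | t < u x} ∪ {x | t < - u x} := by
      intro x hx
      change s < (w x)^2 at hx
      have h1 : Real.sqrt s < |w x| := by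
        rw [Real.sqrt_lt' (lt_of_le_of_ne (abs_nonneg _) (fun h => by
          have : w x = 0 := abs_eq_zero.1 h.symm
          rw [this, zero_pow two_ne_zero] at hx; linarith))]
        rwa [sq_abs]
      have h3 : t < |u x| := by linarith [hwu x]
      rcases lt_abs.1 h3 with h | h
      · exact Or.inl h
      · exact Or.inr h
    refine (measure_mono hsub).trans ((measure_union_le _ _).trans ((add_le_add b1 b2).trans ?_))
    rw [← ENNReal.ofReal_add (by positivity) (by positivity)]
    apply ENNReal.ofReal_le_ofReal
    calc _ = 2 * K * Real.exp (-(α * t^2 / N^2)) := by ring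
      _ ≤ 2 * (K+1) * (Real.exp E * Real.exp (-(q1 * s))) := by gcongr; linarith
      _ = _ := by rw [hV0]; ring
  have := hC _ _ (by positivity) (measurableSet_lt measurable_const (by
    have := hw.measurable
    fun_prop)) hvol
  refine this.trans (le_of_eq ?_)
  congr 1
  rw [Real.mul_rpow hV00.le (Real.exp_pos _).le, ← Real.exp_mul]
  push_cast
  rw [mul_assoc]
  congr 3
  rw [hθ]; ring

end

section
open scoped SchwartzMap LineDeriv Laplacian

lemma sch_dense {n : ℕ} {f : Euc n → ℝ} (hf : MemLp f 2) (d : ℝ) (hd : 0 < d) :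
    ∃ φ : 𝓢(Euc n, ℝ), ∫ x, (f x - φ x)^2 ≤ d := by
  obtain ⟨g, h1, h2, h3⟩ := MemLp.exist_eLpNorm_sub_le (p := 2) (by norm_num) (by norm_num) hf
    (ε := Real.sqrt d) (by positivity)
  refine ⟨h1.toSchwartzMap h2, ?_⟩
  change ∫ x, (f x - g x)^2 ≤ d
  have hg : MemLp g 2 := by
    have h := (h1.toSchwartzMap h2).memLp 2 (μ := volume)
    exact h
  rw [(hf.sub hg).eLpNorm_eq_integral_rpow_norm (by norm_num) (by norm_num)] at h3
  have h0 : 0 ≤ ∫ x, (f x - g x)^2 := integral_nonneg fun x => sq_nonneg _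
  have e : ∫ x, ‖(f - g) x‖ ^ (ENNReal.toReal 2) = ∫ x, (f x - g x)^2 := by
    congr 1; funext x
    simp
  rw [e, ENNReal.ofReal_le_ofReal_iff (Real.sqrt_nonneg _)] at h3
  rw [Real.sqrt_eq_rpow] at h3
  simp only [ENNReal.toReal_ofNat] at h3
  rw [one_div] at h3
  exact (Real.rpow_le_rpow_iff h0 hd.le (by norm_num)).1 h3

lemma gns_nonneg (n γ : ℕ) (u : Euc n → ℝ) (x : Euc n) : 0 ≤ gradNormSq n γ u x := by
  unfold gradNormSq
  split_ifs
  · positivity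
  · exact Finset.sum_nonneg fun i _ => sq_nonneg _

lemma gi_self (n γ : ℕ) (u : Euc n → ℝ) (x : Euc n) :
    gradInner n γ u u x = gradNormSq n γ u x := by
  unfold gradNormSq gradInner
  simp only [sq]

lemma gi_abs (n γ : ℕ) (u v : Euc n → ℝ) (x : Euc n) :
    |gradInner n γ u v x| ≤ gradNormSq n γ u x + gradNormSq n γ v x := by
  have key : ∀ a b : ℝ, |a * b| ≤ a^2 + b^2 := fun a b => by
    rw [abs_mul, ← sq_abs a, ← sq_abs b]; nlinarith [sq_nonneg (|a| - |b|), abs_nonneg a, abs_nonneg b,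
      mul_nonneg (abs_nonneg a) (abs_nonneg b)]
  unfold gradNormSq gradInner
  split_ifs
  · exact key _ _
  · rw [← Finset.sum_add_distrib]
    exact (Finset.abs_sum_le_sum_abs _ _).trans (Finset.sum_le_sum fun i _ => key _ _)

lemma gns_sub {n : ℕ} (γ : ℕ) {u v : Euc n → ℝ} (hu : ContDiff ℝ (⊤ : ℕ∞) u)
    (hv : ContDiff ℝ (⊤ : ℕ∞) v) (x : Euc n) :
    gradNormSq n γ (fun x => u x - v x) x =
      gradNormSq n γ u x - 2 * gradInner n γ u v x + gradNormSq n γ v x := by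
  unfold gradNormSq gradInner
  rw [lapIter_sub hu hv]
  split_ifs
  · ring
  · rw [Finset.mul_sum, ← Finset.sum_sub_distrib, ← Finset.sum_add_distrib]
    refine Finset.sum_congr rfl fun i _ => ?_
    have := congrFun (D_sub (cd_lapIter hu (γ/2)) (cd_lapIter hv (γ/2)) (EuclideanSpace.single i 1)) x
    rw [this]; ring

lemma gi_cont {n : ℕ} (γ : ℕ) {u v : Euc n → ℝ} (hu : ContDiff ℝ (⊤ : ℕ∞) u)
    (hv : ContDiff ℝ (⊤ : ℕ∞) v) : Continuous (gradInner n γ u v) := by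
  unfold gradInner
  have h1 := (cd_lapIter hu (γ/2))
  have h2 := (cd_lapIter hv (γ/2))
  split_ifs
  · exact h1.continuous.mul h2.continuous
  · exact continuous_finsetSum _ fun i _ => (cd_D h1 _).continuous.mul (cd_D h2 _).continuous

/-- energy density -/
def eD (m : ℕ) (a : ℕ → Euc (2*m) → ℝ) (u : Euc (2*m) → ℝ) (x : Euc (2*m)) : ℝ :=
  gradNormSq (2*m) m u x + ∑ γ ∈ Finset.range m, a γ x * gradNormSq (2*m) γ u x

/-- polarised energy density -/
def eI (m : ℕ) (a : ℕ → Euc (2*m) → ℝ) (u v : Euc (2*m) → ℝ) (x : Euc (2*m)) : ℝ :=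
  gradInner (2*m) m u v x + ∑ γ ∈ Finset.range m, a γ x * gradInner (2*m) γ u v x

lemma eI_self (m : ℕ) (a : ℕ → Euc (2*m) → ℝ) (u : Euc (2*m) → ℝ) (x : Euc (2*m)) :
    eI m a u u x = eD m a u x := by
  simp only [eI, eD, gi_self]

lemma eI_abs (m : ℕ) (a : ℕ → Euc (2*m) → ℝ) (ha : ∀ γ < m, ∀ x, 0 ≤ a γ x)
    (u v : Euc (2*m) → ℝ) (x : Euc (2*m)) :
    |eI m a u v x| ≤ eD m a u x + eD m a v x := by
  unfold eI eD
  refine (abs_add_le _ _).trans ?_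
  have h1 := gi_abs (2*m) m u v x
  have h2 : |∑ γ ∈ Finset.range m, a γ x * gradInner (2*m) γ u v x| ≤
      ∑ γ ∈ Finset.range m, a γ x * gradNormSq (2*m) γ u x +
      ∑ γ ∈ Finset.range m, a γ x * gradNormSq (2*m) γ v x := by
    rw [← Finset.sum_add_distrib]
    refine (Finset.abs_sum_le_sum_abs _ _).trans (Finset.sum_le_sum fun γ hγ => ?_)
    have h0 := ha γ (Finset.mem_range.1 hγ) x
    rw [abs_mul, abs_of_nonneg h0, ← mul_add]
    exact mul_le_mul_of_nonneg_left (gi_abs _ _ _ _ _) h0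
  linarith

lemma eD_sub (m : ℕ) (a : ℕ → Euc (2*m) → ℝ) {u v : Euc (2*m) → ℝ}
    (hu : ContDiff ℝ (⊤ : ℕ∞) u) (hv : ContDiff ℝ (⊤ : ℕ∞) v) (x : Euc (2*m)) :
    eD m a (fun x => u x - v x) x = eD m a u x - 2 * eI m a u v x + eD m a v x := by
  unfold eD eI
  simp only [gns_sub _ hu hv]
  simp only [mul_add, mul_sub, Finset.sum_add_distrib, Finset.sum_sub_distrib]
  have : ∑ γ ∈ Finset.range m, a γ x * (2 * gradInner (2*m) γ u v x) =
      2 * ∑ γ ∈ Finset.range m, a γ x * gradInner (2*m) γ u v x := by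
    rw [Finset.mul_sum]; exact Finset.sum_congr rfl fun _ _ => by ring
  rw [this]; ring

lemma eI_int (m : ℕ) (a : ℕ → Euc (2*m) → ℝ) (hcont : ∀ γ < m, Continuous (a γ))
    (ha : ∀ γ < m, ∀ x, 0 ≤ a γ x) {u v : Euc (2*m) → ℝ}
    (hu : ContDiff ℝ (⊤ : ℕ∞) u) (hv : ContDiff ℝ (⊤ : ℕ∞) v)
    (hui : Integrable (eD m a u)) (hvi : Integrable (eD m a v)) : Integrable (eI m a u v) := by
  refine (hui.add hvi).mono' (Continuous.aestronglyMeasurable ?_)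
    (Eventually.of_forall fun x => eI_abs m a ha u v x)
  unfold eI
  exact (gi_cont _ hu hv).add (continuous_finsetSum _ fun γ hγ =>
    (hcont γ (Finset.mem_range.1 hγ)).mul (gi_cont _ hu hv))

lemma eD_ge (m : ℕ) (a : ℕ → Euc (2*m) → ℝ) (lb : ℕ → ℝ)
    (hA1 : ∀ γ < m, 0 < lb γ ∧ ∀ x, lb γ ≤ a γ x) (u : Euc (2*m) → ℝ) (x : Euc (2*m))
    (γ : ℕ) (hγ : γ < m) :
    gradNormSq (2*m) m u x + lb γ * gradNormSq (2*m) γ u x ≤ eD m a u x := by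
  unfold eD
  have h1 : a γ x * gradNormSq (2*m) γ u x ≤
      ∑ γ ∈ Finset.range m, a γ x * gradNormSq (2*m) γ u x :=
    Finset.single_le_sum (f := fun γ => a γ x * gradNormSq (2*m) γ u x) (fun i hi =>
      mul_nonneg ((hA1 i (Finset.mem_range.1 hi)).1.le.trans ((hA1 i (Finset.mem_range.1 hi)).2 x))
        (gns_nonneg _ _ _ _)) (Finset.mem_range.2 hγ)
  have h2 := mul_le_mul_of_nonneg_right ((hA1 γ hγ).2 x) (gns_nonneg (2*m) γ u x)
  linarith

lemma gns_even (n j : ℕ) (u : Euc n → ℝ) (x : Euc n) :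
    gradNormSq n (2*j) u x = (lapIter n j u x)^2 := by
  simp [gradNormSq]

lemma eD_memLp (m M : ℕ) (hm : 1 ≤ m) (hM : m = 2 * M) (a : ℕ → Euc (2*m) → ℝ) (lb : ℕ → ℝ)
    (hA1 : ∀ γ < m, 0 < lb γ ∧ ∀ x, lb γ ≤ a γ x) {u : Euc (2*m) → ℝ}
    (hu : ContDiff ℝ (⊤ : ℕ∞) u) (hui : Integrable (eD m a u)) (j : ℕ) (hj : j ≤ M) :
    MemLp (lapIter (2*m) j u) 2 := by
  have hc := (cd_lapIter hu j).continuous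
  rw [memLp_two_iff_integrable_sq hc.aestronglyMeasurable]
  rcases hj.lt_or_eq with h | h
  · have hl := (hA1 (2*j) (by omega)).1
    refine (hui.const_mul (lb (2*j))⁻¹).mono' (hc.pow 2).aestronglyMeasurable
      (Eventually.of_forall fun x => ?_)
    rw [Real.norm_of_nonneg (sq_nonneg _), ← gns_even, ← div_eq_inv_mul, le_div_iff₀ hl]
    have := eD_ge m a lb hA1 u x (2*j) (by omega)
    linarith [gns_nonneg (2*m) m u x]
  · refine hui.mono' (hc.pow 2).aestronglyMeasurable
      (Eventually.of_forall fun x => ?_)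
    have := eD_ge m a lb hA1 u x 0 (by omega)
    rw [Real.norm_of_nonneg (sq_nonneg _), ← gns_even, h, ← hM]
    linarith [mul_nonneg (hA1 0 (by omega)).1.le (gns_nonneg (2*m) 0 u x)]

lemma eD_P (m M : ℕ) (hm : 1 ≤ m) (hM : m = 2 * M) (a : ℕ → Euc (2*m) → ℝ) (lb : ℕ → ℝ)
    (hA1 : ∀ γ < m, 0 < lb γ ∧ ∀ x, lb γ ≤ a γ x) (u : Euc (2*m) → ℝ) (ε c : ℝ) (hε : 0 < ε)
    (hc : c^2 = ε * lb 0) (x : Euc (2*m)) :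
    (c * u x + (-1)^M * lapIter (2*m) M u x)^2 ≤ (1 + ε) * eD m a u x := by
  have h1 := eD_ge m a lb hA1 u x 0 (by omega)
  have e0 : gradNormSq (2*m) 0 u x = (u x)^2 := gns_even (2*m) 0 u x
  have e1 : gradNormSq (2*m) m u x = ((-1)^M * lapIter (2*m) M u x)^2 := by
    have := gns_even (2*m) M u x
    rw [← hM] at this
    rw [this, mul_pow, ← pow_mul, mul_comm M 2, pow_mul]; simp
  rw [e0, e1] at h1
  set L := (-1)^M * lapIter (2*m) M u x
  have h2 := mul_le_mul_of_nonneg_left h1 (show 0 ≤ 1 + ε by positivity)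
  have h3 : 0 ≤ (c * u x - ε * L)^2 / ε := by positivity
  have e3 : (c * u x - ε * L)^2 / ε = lb 0 * (u x)^2 - 2 * c * u x * L + ε * L^2 := by
    have : (c * u x - ε * L)^2 = ε * (lb 0 * (u x)^2 - 2 * c * u x * L + ε * L^2) := by
      have : (c * u x - ε * L)^2 = c^2 * (u x)^2 - 2 * c * u x * ε * L + ε^2 * L^2 := by ring
      rw [this, hc]; ring
    rw [this]; field_simp
  rw [e3] at h3
  have : (c * u x + L)^2 = (ε * lb 0) * (u x)^2 + 2 * c * u x * L + L^2 := by rw [← hc]; ring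
  rw [this]
  nlinarith

end

section
open scoped SchwartzMap LineDeriv Laplacian

set_option maxHeartbeats 1000000 in
lemma main_aux (m M : ℕ) (hm : 1 ≤ m) (hM : m = 2 * M)
    (β : ℝ) (hβ0 : 0 ≤ β) (hβ : β < 2*m)
    (a : ℕ → Euc (2*m) → ℝ) (hcont : ∀ γ < m, Continuous (a γ))
    (lb : ℕ → ℝ) (hA1 : ∀ γ < m, 0 < lb γ ∧ ∀ x, lb γ ≤ a γ x)
    (w : ℕ → Euc (2*m) → ℝ) (hw : ∀ k, ContDiff ℝ (⊤ : ℕ∞) (w k))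
    (hwint : ∀ k, Integrable (eD m a (w k))) (hwnorm : ∀ k, ∫ x, eD m a (w k) x = 1)
    (w₀ : Euc (2*m) → ℝ) (hw₀ : ContDiff ℝ (⊤ : ℕ∞) w₀)
    (hw₀int : Integrable (eD m a w₀)) (hw₀norm : ∫ x, eD m a w₀ x ≤ 1)
    (hweak : Tendsto (fun k => ∫ x, eI m a (w k) w₀ x) atTop (𝓝 (∫ x, eI m a w₀ w₀ x)))
    (p : ℝ) (hp : 0 < p)
    (hpS : p * (1 - ∫ x, eD m a w₀ x) < (1 - β / (2*m)) * ((4*π)^m * (m.factorial : ℝ))) :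
    ∃ C : ℝ, ∀ k, (∫ x, (Real.exp (p * (w k x)^2) - 1) / ‖x‖ ^ β) ≤ C := by
  have ha : ∀ γ < m, ∀ x, 0 ≤ a γ x := fun γ hγ x => (hA1 γ hγ).1.le.trans ((hA1 γ hγ).2 x)
  have hl0 := (hA1 0 (by omega)).1
  have eD0 : ∀ u x, 0 ≤ eD m a u x := fun u x => by
    have := eD_ge m a lb hA1 u x 0 (by omega)
    have h1 := gns_nonneg (2*m) m u x
    have h2 := mul_nonneg hl0.le (gns_nonneg (2*m) 0 u x)
    linarith
  set S := ∫ x, eD m a w₀ x with hS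
  have hS0 : 0 ≤ S := integral_nonneg (eD0 _)
  set D := 1 - S with hD
  have hD0 : 0 ≤ D := by linarith
  have hD1 : D ≤ 1 := by linarith
  obtain ⟨N2, hN1, hN2⟩ : ∃ N2, D < N2 ∧
      N2 < (1 - β / (2*m)) * ((4*π)^m * (m.factorial : ℝ)) / p := by
    apply exists_between
    rw [lt_div_iff₀ hp]; linarith
  have hN20 : 0 < N2 := by linarith
  set N := Real.sqrt N2 with hN
  have hNsq : N^2 = N2 := Real.sq_sqrt hN20.le
  have hN0 : 0 < N := Real.sqrt_pos.2 hN20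
  set g := N2 - D with hg
  have hg0 : 0 < g := by linarith
  set ε := min 1 (g/6) with hε
  have hε0 : 0 < ε := lt_min one_pos (by positivity)
  have hε1 : ε ≤ 1 := min_le_left _ _
  have hεg : ε ≤ g/6 := min_le_right _ _
  set c := Real.sqrt (ε * lb 0) with hc
  have hc2 : c^2 = ε * lb 0 := Real.sq_sqrt (by positivity)
  have hc0 : 0 < c := Real.sqrt_pos.2 (by positivity)
  set d := g / 4 / (1 + 1/ε) with hd
  have hd0 : 0 < d := by positivity
  have hmem : ∀ {u : Euc (2*m) → ℝ}, ContDiff ℝ (⊤ : ℕ∞) u → Integrable (eD m a u) →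
      ∀ j ≤ M, MemLp (lapIter (2*m) j u) 2 := fun hu hui j hj =>
    eD_memLp m M hm hM a lb hA1 hu hui j hj
  have hmem0 : ∀ {u : Euc (2*m) → ℝ}, ContDiff ℝ (⊤ : ℕ∞) u → Integrable (eD m a u) →
      MemLp u 2 := fun hu hui => hmem hu hui 0 (Nat.zero_le _)
  set P : (Euc (2*m) → ℝ) → Euc (2*m) → ℝ := fun u x =>
    c * u x + (-1)^M * lapIter (2*m) M u x with hPdef
  have hPsub : ∀ {u v : Euc (2*m) → ℝ}, ContDiff ℝ (⊤ : ℕ∞) u → ContDiff ℝ (⊤ : ℕ∞) v → ∀ x,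
      P (fun x => u x - v x) x = P u x - P v x := fun hu hv x => by
    simp only [hPdef]; rw [lapIter_sub hu hv]; ring
  have hPmem : ∀ {u : Euc (2*m) → ℝ}, (∀ j ≤ M, MemLp (lapIter (2*m) j u) 2) → MemLp (P u) 2 :=
    fun {u} h => by
      have h0 : MemLp u 2 (volume : Measure (Euc (2*m))) := h 0 (Nat.zero_le _)
      exact (h0.const_mul c).add ((h M le_rfl).const_mul _)
  obtain ⟨f, hf⟩ := sch_dense (hPmem (hmem hw₀ hw₀int)) d hd0
  obtain ⟨h, hh, -⟩ := inv_op c hc0 M f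
  have hhcd : ContDiff ℝ (⊤ : ℕ∞) (h : Euc (2*m) → ℝ) := sch_cd h
  have hPh : ∀ x, P h x = f x := fun x => by
    simp only [hPdef]; rw [lapIter_schwartz, ← hh x]
  obtain ⟨H, hH0, hH⟩ := sch_bdd h
  have hhmem : ∀ j ≤ M, MemLp (lapIter (2*m) j h) 2 := fun j _ => by
    rw [lapIter_schwartz]; exact SchwartzMap.memLp _ 2 volume
  have hpN : p * N^2 < (1 - β / (2*m)) * ((4*π)^m * (m.factorial : ℝ)) := by
    rw [hNsq]; rw [lt_div_iff₀ hp] at hN2; linarith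
  obtain ⟨C, hC⟩ := combine m M hm hM c hc0 β hβ0 hβ p N H (lb 0)⁻¹
    (2 * (lb 0)⁻¹ + 2 * ∫ x, (h x)^2) hp hN0 hH0 hpN
  -- bound on w
  have hwi : ∀ k, Integrable (fun x => (w k x)^2) := fun k => (hmem0 (hw k) (hwint k)).integrable_sq
  have hwB : ∀ k, ∫ x, (w k x)^2 ≤ (lb 0)⁻¹ := fun k => by
    have : ∫ x, lb 0 * (w k x)^2 ≤ ∫ x, eD m a (w k) x := by
      refine integral_mono ((hwi k).const_mul _) (hwint k) fun x => ?_
      have h1 := eD_ge m a lb hA1 (w k) x 0 (by omega)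
      have h2 := gns_nonneg (2*m) m (w k) x
      have h3 : gradNormSq (2*m) 0 (w k) x = (w k x)^2 := gns_even (2*m) 0 (w k) x
      rw [h3] at h1
      dsimp only
      linarith
    rw [integral_const_mul, hwnorm k] at this
    rw [← one_div, le_div_iff₀ hl0]; linarith
  -- convergence
  have hr : ∀ k, Integrable (eD m a (fun x => w k x - w₀ x)) ∧
      ∫ x, eD m a (fun x => w k x - w₀ x) x = 1 - 2 * (∫ x, eI m a (w k) w₀ x) + S := fun k => by
    have i1 := eI_int m a hcont ha (hw k) hw₀ (hwint k) hw₀int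
    have e : eD m a (fun x => w k x - w₀ x) =
        fun x => eD m a (w k) x - 2 * eI m a (w k) w₀ x + eD m a w₀ x :=
      funext fun x => eD_sub m a (hw k) hw₀ x
    have i2 : Integrable (fun x => eD m a (w k) x - 2 * eI m a (w k) w₀ x) :=
      (hwint k).sub (i1.const_mul 2)
    rw [e]
    refine ⟨i2.add hw₀int, ?_⟩
    rw [integral_add i2 hw₀int, integral_sub (hwint k) (i1.const_mul 2), integral_const_mul,
      hwnorm k]
  have hlim : Tendsto (fun k => ∫ x, eD m a (fun x => w k x - w₀ x) x) atTop (𝓝 D) := by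
    have : (fun k => ∫ x, eD m a (fun x => w k x - w₀ x) x) =
        fun k => 1 - 2 * (∫ x, eI m a (w k) w₀ x) + S := funext fun k => (hr k).2
    rw [this]
    have e : ∫ x, eI m a w₀ w₀ x = S := by simp_rw [eI_self]; rfl
    rw [e] at hweak
    have := ((hweak.const_mul 2).const_sub 1).add_const S
    rwa [show 1 - 2 * S + S = D by rw [hD]; ring] at this
  have hev : ∀ᶠ k in atTop, ∫ x, (Real.exp (p * (w k x)^2) - 1) / ‖x‖ ^ β ≤ C := by
    filter_upwards [hlim.eventually (gt_mem_nhds (show D < D + g/32 by linarith))] with k hk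
    have hucd : ContDiff ℝ (⊤ : ℕ∞) (fun x => w k x - h x) := (hw k).sub hhcd
    refine hC (w k) (fun x => w k x - h x) (hw k).continuous hucd (fun j hj => ?_) ?_ ?_
      (fun x => ?_) (hwi k) (hwB k)
    · rw [lapIter_sub (hw k) hhcd]
      exact (hmem (hw k) (hwint k) j hj).sub (hhmem j hj)
    · change ∫ x, (P (fun x => w k x - h x) x)^2 ≤ N^2
      have hrcd : ContDiff ℝ (⊤ : ℕ∞) (fun x => w k x - w₀ x) := (hw k).sub hw₀
      have i3 : Integrable (fun x => (P w₀ x - f x)^2) :=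
        ((hPmem (hmem hw₀ hw₀int)).sub (f.memLp 2)).integrable_sq
      have pt : ∀ x, (P (fun x => w k x - h x) x)^2 ≤
          (1+ε)^2 * eD m a (fun x => w k x - w₀ x) x + (1 + 1/ε) * (P w₀ x - f x)^2 := by
        intro x
        have h1 : P (fun x => w k x - h x) x = P (fun x => w k x - w₀ x) x + (P w₀ x - f x) := by
          rw [hPsub (hw k) hhcd, hPsub (hw k) hw₀, hPh]; ring
        have h2 : (P (fun x => w k x - w₀ x) x)^2 ≤ _ :=
          eD_P m M hm hM a lb hA1 (fun x => w k x - w₀ x) ε c hε0 hc2 x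
        rw [h1]
        set X := P (fun x => w k x - w₀ x) x
        set Y := P w₀ x - f x
        have h3 : 0 ≤ (ε * X - Y)^2 / ε := by positivity
        have e3 : (ε * X - Y)^2 / ε = ε * X^2 - 2 * X * Y + 1/ε * Y^2 := by field_simp; ring
        rw [e3] at h3
        have h4 := mul_le_mul_of_nonneg_left h2 (show 0 ≤ 1 + ε by positivity)
        nlinarith
      calc _ ≤ ∫ x, ((1+ε)^2 * eD m a (fun x => w k x - w₀ x) x +
              (1 + 1/ε) * (P w₀ x - f x)^2) :=
            integral_mono_of_nonneg (Eventually.of_forall fun x => sq_nonneg _)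
              (((hr k).1.const_mul _).add (i3.const_mul _)) (Eventually.of_forall pt)
        _ = (1+ε)^2 * (∫ x, eD m a (fun x => w k x - w₀ x) x) +
              (1 + 1/ε) * ∫ x, (P w₀ x - f x)^2 := by
            rw [integral_add ((hr k).1.const_mul _) (i3.const_mul _), integral_const_mul,
              integral_const_mul]
        _ ≤ (1+ε)^2 * (D + g/32) + (1 + 1/ε) * d := by gcongr
        _ ≤ N^2 := by
            have e1 : (1 + 1/ε) * d = g/4 := by
              rw [hd]; have : (1 + 1/ε) ≠ 0 := by positivity
              field_simp
            have e2 : (1+ε)^2 ≤ 1 + 3*ε := by nlinarith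
            have e3 : (1+ε)^2 * D ≤ D + 3 * ε := by nlinarith
            have e4 : (1+ε)^2 * (g/32) ≤ 4 * (g/32) := by
              gcongr; linarith
            rw [e1, hNsq]
            have : N2 = D + g := by rw [hg]; ring
            rw [this]
            linarith
    · have i4 : Integrable (fun x => (h x)^2) := (h.memLp 2).integrable_sq
      calc _ ≤ ∫ x, (2 * (w k x)^2 + 2 * (h x)^2) := by
            refine integral_mono_of_nonneg (Eventually.of_forall fun x => sq_nonneg _)
              (((hwi k).const_mul 2).add (i4.const_mul 2)) (Eventually.of_forall fun x => ?_)
            dsimp only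
            nlinarith [sq_nonneg (w k x + h x)]
        _ = 2 * (∫ x, (w k x)^2) + 2 * ∫ x, (h x)^2 := by
            rw [integral_add ((hwi k).const_mul 2) (i4.const_mul 2), integral_const_mul,
              integral_const_mul]
        _ ≤ _ := by gcongr; exact hwB k
    · have h1 := abs_add_le (w k x - h x) (h x)
      rw [sub_add_cancel] at h1
      linarith [hH x]
  obtain ⟨k0, hk0⟩ := eventually_atTop.1 hev
  refine ⟨|C| + ∑ k ∈ Finset.range k0, |∫ x, (Real.exp (p * (w k x)^2) - 1) / ‖x‖ ^ β|, fun k => ?_⟩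
  have hsum : 0 ≤ ∑ k ∈ Finset.range k0, |∫ x, (Real.exp (p * (w k x)^2) - 1) / ‖x‖ ^ β| :=
    Finset.sum_nonneg fun _ _ => abs_nonneg _
  rcases le_or_gt k0 k with hk | hk
  · have := hk0 k hk
    linarith [le_abs_self C]
  · have := Finset.single_le_sum
      (f := fun k => |∫ x, (Real.exp (p * (w k x)^2) - 1) / ‖x‖ ^ β|)
      (fun _ _ => abs_nonneg _) (Finset.mem_range.2 hk)
    linarith [le_abs_self (∫ x, (Real.exp (p * (w k x)^2) - 1) / ‖x‖ ^ β), abs_nonneg C]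

end

/-- Singular Lions-type concentration-compactness inequality (Lemma 4.4). The admissible
range of `p` is encoded as `p (1 - ‖w₀‖_E²) < (1 - β/(2m)) (4π)^m m!`, which for
`‖w₀‖_E = 1` holds for every `p > 0`. -/
theorem singular_lions_inequality (m : ℕ) (hm : 2 ≤ m) (hme : Even m)
    (β : ℝ) (hβ0 : 0 ≤ β) (hβ : β < 2*m)
    (a : ℕ → Euc (2*m) → ℝ) (hcont : ∀ γ < m, Continuous (a γ))
    (lb : ℕ → ℝ) (hA1 : ∀ γ < m, 0 < lb γ ∧ ∀ x, lb γ ≤ a γ x)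
    (w : ℕ → Euc (2*m) → ℝ) (hw : ∀ k, ContDiff ℝ (⊤ : ℕ∞) (w k))
    (hwsob : ∀ k, Integrable (fun x => ∑ γ ∈ Finset.range (m+1), gradNormSq (2*m) γ (w k) x))
    (hwint : ∀ k, Integrable (fun x => gradNormSq (2*m) m (w k) x +
      ∑ γ ∈ Finset.range m, a γ x * gradNormSq (2*m) γ (w k) x))
    (hwnorm : ∀ k, (∫ x, (gradNormSq (2*m) m (w k) x +
      ∑ γ ∈ Finset.range m, a γ x * gradNormSq (2*m) γ (w k) x)) = 1)
    (w₀ : Euc (2*m) → ℝ) (hw₀ : ContDiff ℝ (⊤ : ℕ∞) w₀)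
    (hw₀int : Integrable (fun x => gradNormSq (2*m) m w₀ x +
      ∑ γ ∈ Finset.range m, a γ x * gradNormSq (2*m) γ w₀ x))
    (hw₀norm : (∫ x, (gradNormSq (2*m) m w₀ x +
      ∑ γ ∈ Finset.range m, a γ x * gradNormSq (2*m) γ w₀ x)) ≤ 1)
    (hweak : ∀ v : Euc (2*m) → ℝ, ContDiff ℝ (⊤ : ℕ∞) v →
      Integrable (fun x => gradNormSq (2*m) m v x +
        ∑ γ ∈ Finset.range m, a γ x * gradNormSq (2*m) γ v x) →
      Filter.Tendsto (fun k => ∫ x, (gradInner (2*m) m (w k) v x +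
          ∑ γ ∈ Finset.range m, a γ x * gradInner (2*m) γ (w k) v x))
        Filter.atTop (nhds (∫ x, (gradInner (2*m) m w₀ v x +
          ∑ γ ∈ Finset.range m, a γ x * gradInner (2*m) γ w₀ v x)))) :
    ∀ p : ℝ, 0 < p →
      p * (1 - (∫ x, (gradNormSq (2*m) m w₀ x +
          ∑ γ ∈ Finset.range m, a γ x * gradNormSq (2*m) γ w₀ x)))
        < (1 - β / (2*m)) * ((4*π)^m * (m.factorial : ℝ)) →
      ∃ C : ℝ, ∀ k, (∫ x, (Real.exp (p * (w k x)^2) - 1) / ‖x‖ ^ β) ≤ C := by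
  intro p hp hpS
  obtain ⟨M, hM⟩ := hme
  exact main_aux m M (by omega) (by omega) β hβ0 hβ a hcont lb hA1 w hw hwint hwnorm w₀ hw₀ hw₀int
    hw₀norm (hweak w₀ hw₀ hw₀int) p hp hpS
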